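/- For any real number Λ ≥ 0 and any function f: ℝ → ℝ satisfying condition (f), there exists a strictly increasing sequence of positive integers (n_k)_{k≥1} with n_{k+1} − n_k ∈ {1,2} for all k ≥ 1 such that limsup_{N→∞} |∑_{k=1}^N f(n_k x)| / √(N log log N) = Λ‖f‖ for almost every real number x. -/

import Mathlib

open MeasureTheory Filter Finset Real

/-- The `L²(0,1)` norm of a function. -/
noncomputable def L2norm (f : ℝ → ℝ) : ℝ :=
  Real.sqrt (∫ x in (0:ℝ)..1, (f x) ^ 2)

section Part1
open MeasureTheory Filter Finset Real

/-- `g` is 1-periodic and its increments are dominated by those of the monotone `v`, whose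
increment over a period is `V`. -/
structure BVP (g v : ℝ → ℝ) (V : ℝ) : Prop where
  mono : Monotone v
  vper : ∀ x, v (x + 1) = v x + V
  gper : ∀ x, g (x + 1) = g x
  bd : ∀ x y, x ≤ y → |g y - g x| ≤ v y - v x

theorem per_int {g : ℝ → ℝ} (h : ∀ x, g (x + 1) = g x) (n : ℤ) (x : ℝ) : g (x + n) = g x := by
  have : Function.Periodic g 1 := h
  simpa using this.int_mul n x

theorem evar_shift {f : ℝ → ℝ} (h : ∀ x, f (x + 1) = f x) (n : ℤ) (a b : ℝ) :
    eVariationOn f (Set.Icc (a + n) (b + n)) = eVariationOn f (Set.Icc a b) := by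
  have h1 := eVariationOn.comp_eq_of_monotoneOn f (t := Set.Icc a b) (fun x => x + (n:ℝ))
    (fun x _ y _ hxy => by simpa using hxy)
  have h2 : f ∘ (fun x => x + (n:ℝ)) = f := by
    funext x; exact per_int h n x
  rw [h2, Set.image_add_const_Icc] at h1
  exact h1.symm

theorem exists_BVP (f : ℝ → ℝ) (hper : ∀ x : ℝ, f (x + 1) = f x)
    (hbv : BoundedVariationOn f (Set.Icc 0 1)) : ∃ v V, BVP f v V := by
  have key : ∀ n : ℕ, eVariationOn f (Set.Icc (-(n:ℝ)) n) ≠ ⊤ := by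
    intro n
    have hs := eVariationOn.sum' f (I := fun i : ℕ => -(n:ℝ) + i) (n := 2 * n)
      (fun i j hij => by simpa using hij)
    have e : -(n:ℝ) + ((2 * n : ℕ) : ℝ) = n := by push_cast; ring
    simp only [e, Nat.cast_zero, add_zero] at hs
    rw [← hs]
    refine ENNReal.sum_ne_top.2 fun i _ => ?_
    have := evar_shift hper (-(n:ℤ) + i) 0 1
    have e1 : (0:ℝ) + ((-(n:ℤ) + i : ℤ):ℝ) = -(n:ℝ) + i := by push_cast; ring
    have e2 : (1:ℝ) + ((-(n:ℤ) + i : ℤ):ℝ) = -(n:ℝ) + (i + 1 : ℕ) := by push_cast; ring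
    rw [e1, e2] at this
    rw [this]; exact hbv
  have hl : LocallyBoundedVariationOn f Set.univ := by
    intro a b _ _
    obtain ⟨n, hn⟩ := exists_nat_ge (max |a| |b|)
    have h1 := neg_le_abs a
    have h2 := le_abs_self b
    have h3 := le_max_left |a| |b|
    have h4 := le_max_right |a| |b|
    refine BoundedVariationOn.mono (key n) ?_
    rw [Set.univ_inter]
    exact Set.Icc_subset_Icc (by linarith) (by linarith)
  have tr : ∀ a b, variationOnFromTo f Set.univ (a + 1) (b + 1)
      = variationOnFromTo f Set.univ a b := by
    intro a b
    have h1 := variationOnFromTo.comp_eq_of_monotoneOn f (t := Set.univ) (fun x => x + (1:ℝ))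
      (fun x _ y _ hxy => by simpa using hxy) (Set.mem_univ a) (Set.mem_univ b)
    have h2 : f ∘ (fun x => x + (1:ℝ)) = f := by funext x; exact hper x
    have h3 : (fun x => x + (1:ℝ)) '' Set.univ = Set.univ := by
      rw [Set.image_univ]; exact (Equiv.addRight (1:ℝ)).surjective.range_eq
    rw [h2, h3] at h1
    exact h1.symm
  refine ⟨variationOnFromTo f Set.univ 0, variationOnFromTo f Set.univ 0 1, ?_, ?_, hper, ?_⟩
  · have := variationOnFromTo.monotoneOn (f := f) hl (Set.mem_univ 0)
    exact monotoneOn_univ.1 this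
  · intro x
    have u := Set.mem_univ (α := ℝ)
    have h1 := variationOnFromTo.add hl (u 0) (u 1) (u (x + 1))
    have h2 := tr 0 x
    rw [zero_add] at h2
    linarith
  · intro x y hxy
    exact variationOnFromTo.abs_sub_le_sub_of_le hl (Set.mem_univ _) (Set.mem_univ _)
      (Set.mem_univ _) hxy

namespace BVP
variable {g v : ℝ → ℝ} {V : ℝ}

theorem V_nonneg (h : BVP g v V) : 0 ≤ V := by
  have := h.mono (show (0:ℝ) ≤ 0 + 1 by norm_num)
  rw [h.vper] at this; linarith

theorem meas (h : BVP g v V) : Measurable g := by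
  have h1 : Monotone (fun x => g x + v x) := by
    intro x y hxy
    have := neg_le_of_abs_le (h.bd x y hxy)
    dsimp only; linarith
  have h2 := h1.measurable.sub h.mono.measurable
  have : (fun x => g x + v x) - v = g := by funext x; simp
  rwa [this] at h2

theorem osc (h : BVP g v V) (x y : ℝ) : |g x - g y| ≤ V := by
  have e : g (Int.fract (x - y) + y) = g x := by
    have := per_int h.gper ⌊x - y⌋ (Int.fract (x - y) + y)
    rw [← this]; congr 1
    have := Int.fract_add_floor (x - y)
    linarith
  rw [← e]
  have h0 := Int.fract_nonneg (x - y)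
  have h1 := (Int.fract_lt_one (x - y)).le
  refine (h.bd y _ (by linarith)).trans ?_
  have := h.mono (show Int.fract (x - y) + y ≤ y + 1 by linarith)
  rw [h.vper] at this; linarith

theorem bounded (h : BVP g v V) (x : ℝ) : |g x| ≤ |g 0| + V := by
  have h1 := h.osc x 0
  calc |g x| = |g 0 + (g x - g 0)| := by ring_nf
    _ ≤ _ := (abs_add_le _ _).trans (by linarith)

theorem ii (h : BVP g v V) (a b : ℝ) : IntervalIntegrable g volume a b := by
  have h1 : Monotone (fun x => g x + v x) := by
    intro x y hxy
    have := neg_le_of_abs_le (h.bd x y hxy)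
    dsimp only; linarith
  have h2 := (h1.intervalIntegrable (μ := volume) (a := a) (b := b)).sub
    (h.mono.intervalIntegrable (μ := volume) (a := a) (b := b))
  simpa using h2

theorem int_shift (h : BVP g v V) (a : ℝ) : ∫ x in a..a+1, g x = ∫ x in (0:ℝ)..1, g x := by
  have : Function.Periodic g 1 := h.gper
  have := this.intervalIntegral_add_eq a 0
  simpa using this

/-- Error on a single cell. -/
theorem cell (h : BVP g v V) {a b t : ℝ} (hat : a ≤ t) (htb : t ≤ b) :
    |(b - a) * g t - ∫ x in a..b, g x| ≤ (b - a) * (v b - v a) := by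
  have hab : a ≤ b := hat.trans htb
  have e : (b - a) * g t - ∫ x in a..b, g x = ∫ x in a..b, (g t - g x) := by
    rw [intervalIntegral.integral_sub intervalIntegrable_const (h.ii a b)]
    simp
  rw [e]
  have := intervalIntegral.norm_integral_le_of_norm_le_const (f := fun x => g t - g x)
    (a := a) (b := b) (C := v b - v a) ?_
  · rw [abs_of_nonneg (by linarith : 0 ≤ b - a)] at this
    rw [← Real.norm_eq_abs]; linarith
  · intro x hx
    rw [Set.uIoc_of_le hab] at hx
    rw [Real.norm_eq_abs]
    rcases le_total x t with hxt | hxt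
    · refine (h.bd _ _ hxt).trans ?_
      have := h.mono htb; have := h.mono hx.1.le; linarith
    · rw [abs_sub_comm]
      refine (h.bd _ _ hxt).trans ?_
      have := h.mono hat; have := h.mono hx.2; linarith

theorem mean (h : BVP g v V) (t : ℝ) : |g t - ∫ x in (0:ℝ)..1, g x| ≤ V := by
  have := h.cell (a := t) (b := t + 1) le_rfl (by linarith)
  rw [h.int_shift, h.vper] at this
  simpa using this

theorem pos_part (h : BVP g v V) : BVP (fun x => max (g x) 0) v V := by
  refine ⟨h.mono, h.vper, fun x => by simp only [h.gper], fun x y hxy => ?_⟩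
  refine le_trans ?_ (h.bd x y hxy)
  exact abs_max_sub_max_le_abs _ _ _

theorem neg (h : BVP g v V) : BVP (fun x => - g x) v V := by
  refine ⟨h.mono, h.vper, fun x => by simp only [h.gper], fun x y hxy => ?_⟩
  have e : -g y - -g x = -(g y - g x) := by ring
  simp only [e, abs_neg]
  exact h.bd x y hxy

/-- The modulus function `v(t+s) - v(t)`. -/
theorem modulus (h : BVP g v V) (s : ℝ) :
    BVP (fun t => v (t + s) - v t) (fun t => v (t + s) + v t) (2 * V) := by
  refine ⟨?_, fun x => ?_, fun x => ?_, fun x y hxy => ?_⟩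
  · intro x y hxy
    have := h.mono hxy
    have := h.mono (show x + s ≤ y + s by linarith)
    dsimp only; linarith
  · rw [show x + 1 + s = (x + s) + 1 by ring, h.vper, h.vper]; ring
  · rw [show x + 1 + s = (x + s) + 1 by ring, h.vper, h.vper]; ring
  · have := h.mono hxy
    have := h.mono (show x + s ≤ y + s by linarith)
    rw [abs_le]; constructor <;> linarith

theorem modulus_int (h : BVP g v V) (s : ℝ) :
    ∫ t in (0:ℝ)..1, (v (t + s) - v t) = s * V := by
  have ii : ∀ a b, IntervalIntegrable v volume a b := fun a b => h.mono.intervalIntegrable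
  have i1 : IntervalIntegrable (fun t => v (t + s)) volume 0 1 := by
    have : Monotone (fun t => v (t + s)) := fun x y hxy => h.mono (by linarith)
    exact this.intervalIntegrable
  rw [intervalIntegral.integral_sub i1 (ii _ _)]
  rw [intervalIntegral.integral_comp_add_right (fun t => v t)]
  have e1 : ∫ x in (0 + s)..(1 + s), v x = (∫ x in (0+s)..(1:ℝ), v x) + ∫ x in (1:ℝ)..(1 + s), v x :=
    (intervalIntegral.integral_add_adjacent_intervals (ii _ _) (ii _ _)).symm
  have e2 : ∫ x in (0:ℝ)..1, v x = (∫ x in (0:ℝ)..(0 + s), v x) + ∫ x in (0+s)..(1:ℝ), v x :=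
    (intervalIntegral.integral_add_adjacent_intervals (ii _ _) (ii _ _)).symm
  have e3 : ∫ x in (1:ℝ)..(1 + s), v x = ∫ x in (0:ℝ)..s, (v x + V) := by
    have := intervalIntegral.integral_comp_add_right (a := 0) (b := s) (fun t => v t) 1
    rw [zero_add, add_comm s 1] at this
    rw [← this]
    exact intervalIntegral.integral_congr fun x _ => h.vper x
  rw [e1, e2, e3, intervalIntegral.integral_add (ii _ _) intervalIntegrable_const]
  simp
  ring
end BVP

end Part1

section Part2
open MeasureTheory Filter Finset Real

theorem dk_aux {g v : ℝ → ℝ} {V : ℝ} (h : BVP g v V) (q : ℕ) (hq : 0 < q) (φ : ℝ)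
    (i : ℕ → ℕ) (e : ℕ → ℝ) (hi : ∀ j < q, i j < q)
    (hinj : ∀ j < q, ∀ k < q, i j = i k → j = k)
    (he0 : ∀ j < q, 0 ≤ e j) (he1 : ∀ j < q, e j ≤ 1 / q) :
    |∑ j ∈ range q, g (φ + i j / q + e j) - q * ∫ x in (0:ℝ)..1, g x| ≤ V := by
  have hq' : (0:ℝ) < q := by exact_mod_cast hq
  have reidx : ∀ F : ℕ → ℝ, ∑ j ∈ range q, F (i j) = ∑ k ∈ range q, F k := by
    intro F
    have himg : (range q).image i = range q := by
      apply Finset.eq_of_subset_of_card_le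
      · intro x hx
        obtain ⟨j, hj, rfl⟩ := Finset.mem_image.1 hx
        exact Finset.mem_range.2 (hi j (Finset.mem_range.1 hj))
      · rw [Finset.card_image_of_injOn]
        intro a ha b hb hab
        exact hinj a (by simpa using ha) b (by simpa using hb) hab
    conv_rhs => rw [← himg]
    rw [Finset.sum_image]
    intro a ha b hb hab
    exact hinj a (by simpa using ha) b (by simpa using hb) hab
  set P : ℕ → ℝ := fun k => φ + k / q with hP
  have hPs : ∀ k, P (k + 1) - P k = 1 / q := by
    intro k; simp only [hP]; push_cast; field_simp; ring
  have P0 : P 0 = φ := by simp [hP]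
  have Pq : P q = φ + 1 := by simp only [hP]; field_simp
  have hint : ∑ k ∈ range q, ∫ x in P k..P (k+1), g x = ∫ x in (0:ℝ)..1, g x := by
    rw [intervalIntegral.sum_integral_adjacent_intervals (fun k _ => h.ii _ _), P0, Pq, h.int_shift]
  have hv : ∑ k ∈ range q, (v (P (k+1)) - v (P k)) = V := by
    rw [Finset.sum_range_sub (fun k => v (P k)), P0, Pq, h.vper]; ring
  rw [← hint, ← reidx (fun k => ∫ x in P k..P (k+1), g x), Finset.mul_sum, ← Finset.sum_sub_distrib,
    ← hv, ← reidx (fun k => v (P (k+1)) - v (P k))]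
  refine (Finset.abs_sum_le_sum_abs _ _).trans (Finset.sum_le_sum fun j hj => ?_)
  have hj := Finset.mem_range.1 hj
  have h1 : P (i j) ≤ φ + i j / q + e j := by simp only [hP]; linarith [he0 j hj]
  have h2 : φ + i j / q + e j ≤ P (i j + 1) := by
    have := hPs (i j); have := he1 j hj; simp only [hP] at *; linarith
  have := h.cell h1 h2
  rw [hPs] at this
  set A := g (φ + i j / q + e j)
  set B := ∫ x in P (i j)..P (i j + 1), g x
  set D := v (P (i j + 1)) - v (P (i j))
  have e1 : A - q * B = q * (1 / q * A - B) := by field_simp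
  rw [e1, abs_mul, abs_of_pos hq']
  calc (q:ℝ) * |1 / q * A - B| ≤ q * (1 / q * D) := by gcongr
    _ = D := by field_simp

theorem denjoy_koksma {g v : ℝ → ℝ} {V : ℝ} (h : BVP g v V) (q : ℕ) (hq : 0 < q) (p : ℤ)
    (hco : IsCoprime p (q:ℤ)) (y : ℝ) (hy : |y - p / q| ≤ 1 / (q:ℝ) ^ 2) (φ : ℝ) :
    |∑ j ∈ range q, g (φ + j * y) - q * ∫ x in (0:ℝ)..1, g x| ≤ V := by
  have hq' : (0:ℝ) < q := by exact_mod_cast hq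
  have hqz : (0:ℤ) < q := by exact_mod_cast hq
  set δ := y - p / q with hδ
  have hjδ : ∀ j < q, |(j:ℝ) * δ| ≤ 1 / q := by
    intro j hj
    rw [abs_mul, Nat.abs_cast]
    have : (j:ℝ) ≤ q := by exact_mod_cast hj.le
    calc (j:ℝ) * |δ| ≤ q * (1 / (q:ℝ)^2) := by gcongr
      _ = 1 / q := by field_simp
  set i : ℕ → ℕ := fun j => ((j * p) % (q:ℤ)).toNat with hi
  have hi0 : ∀ j, ((i j : ℕ) : ℤ) = (j * p) % (q:ℤ) := fun j =>
    Int.toNat_of_nonneg (Int.emod_nonneg _ hqz.ne')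
  have hilt : ∀ j < q, i j < q := by
    intro j _
    have := Int.emod_lt_of_pos ((j:ℤ) * p) hqz
    rw [← hi0] at this; exact_mod_cast this
  have hinj : ∀ j < q, ∀ k < q, i j = i k → j = k := by
    intro j hj k hk hjk
    have h1 : ((j:ℤ) * p) % (q:ℤ) = (k * p) % (q:ℤ) := by rw [← hi0, ← hi0, hjk]
    have h2 : (q:ℤ) ∣ (k - j) * p := by
      rw [sub_mul]; exact Int.ModEq.dvd h1
    have h3 : (q:ℤ) ∣ k - j := hco.symm.dvd_of_dvd_mul_right h2
    have h4 := Int.eq_zero_of_abs_lt_dvd h3 (by rw [abs_lt]; constructor <;> omega)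
    omega
  have hg : ∀ j : ℕ, g (φ + j * y) = g (φ + i j / q + j * δ) := by
    intro j
    have h1 : ((i j : ℕ):ℤ) + q * ((j * p) / (q:ℤ)) = j * p := by
      rw [hi0]; exact Int.emod_add_mul_ediv _ _
    have h2 : ((i j : ℕ):ℝ) + q * (((j * p) / (q:ℤ) : ℤ):ℝ) = j * p := by exact_mod_cast h1
    rw [← per_int h.gper ((j * p) / (q:ℤ)) (φ + i j / q + j * δ)]
    congr 1
    have h3 : (p:ℝ) * j = i j + q * (((j * p) / (q:ℤ) : ℤ):ℝ) := by linarith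
    have h4 : (j:ℝ) * p / q = i j / q + (((j * p) / (q:ℤ) : ℤ):ℝ) := by
      rw [mul_comm, h3]; field_simp
    rw [hδ, mul_sub, ← mul_div_assoc, h4]; ring
  rcases le_total 0 δ with hd | hd
  · have := dk_aux h q hq φ i (fun j => j * δ) hilt hinj (fun j _ => by positivity)
      (fun j hj => (le_abs_self _).trans (hjδ j hj))
    simpa only [hg] using this
  · have := dk_aux h q hq (φ - 1 / q) i (fun j => 1 / q + j * δ) hilt hinj
      (fun j hj => by have := neg_le_of_abs_le (hjδ j hj); linarith)
      (fun j hj => by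
        have : (j:ℝ) * δ ≤ 0 := mul_nonpos_of_nonneg_of_nonpos (by positivity) hd
        linarith)
    have e : ∀ j : ℕ, φ - 1 / q + i j / q + (1 / q + j * δ) = φ + i j / q + j * δ := fun j => by ring
    simp only [e] at this
    simpa only [hg] using this

theorem dk_mul {g v : ℝ → ℝ} {V : ℝ} (h : BVP g v V) (q : ℕ) (hq : 0 < q) (p : ℤ)
    (hco : IsCoprime p (q:ℤ)) (y : ℝ) (hy : |y - p / q| ≤ 1 / (q:ℝ) ^ 2) (φ : ℝ) (b : ℕ) :
    |∑ j ∈ range (b * q), g (φ + j * y) - (b * q : ℕ) * ∫ x in (0:ℝ)..1, g x| ≤ b * V := by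
  induction b with
  | zero => simp
  | succ b ih =>
    rw [add_mul, one_mul, Finset.sum_range_add]
    have := denjoy_koksma h q hq p hco y hy (φ + (b * q : ℕ) * y)
    have e : ∀ j : ℕ, φ + ((b * q + j : ℕ):ℝ) * y = φ + (b * q : ℕ) * y + j * y := by
      intro j; push_cast; ring
    simp only [e]
    calc _ = |(∑ j ∈ range (b * q), g (φ + j * y) - (b * q : ℕ) * ∫ x in (0:ℝ)..1, g x)
        + (∑ j ∈ range q, g (φ + (b * q : ℕ) * y + j * y) - q * ∫ x in (0:ℝ)..1, g x)| := by
          congr 1; push_cast; ring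
      _ ≤ _ := (abs_add_le _ _).trans (by push_cast at *; linarith)

/-- Diophantine condition: good approximations in each range `[n^{3/4}, n]`. -/
def Dio (y : ℝ) : Prop := ∃ n0 : ℕ, ∀ n ≥ n0, ∃ q : ℕ, ∃ p : ℤ, 0 < q ∧ q ≤ n ∧
  (n:ℝ) ^ (3/4:ℝ) ≤ q ∧ IsCoprime p (q:ℤ) ∧ |y - p / q| ≤ 1 / (q:ℝ) ^ 2

theorem dio_of {y : ℝ} (hirr : Irrational y) (hL : ¬ LiouvilleWith (7/3) y) : Dio y := by
  have h1 : ∀ᶠ n : ℕ in atTop, ∀ m : ℤ, 1 / (n:ℝ) ^ (7/3:ℝ) ≤ |y - m / n| := by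
    by_contra hc
    apply hL
    refine ⟨1, ?_⟩
    rw [Filter.not_eventually] at hc
    refine hc.mono fun n hn => ?_
    push Not at hn
    obtain ⟨m, hm⟩ := hn
    refine ⟨m, ?_, hm⟩
    intro he
    apply hirr
    exact ⟨(m:ℚ) / n, by push_cast; exact he.symm⟩
  obtain ⟨n1, hn1⟩ := eventually_atTop.1 h1
  have h2 : ∃ δ > 0, ∀ d : ℕ, 0 < d → d < n1 → ∀ m : ℤ, δ ≤ |d * y - m| := by
    clear hn1
    induction n1 with
    | zero => exact ⟨1, one_pos, fun d _ h => by omega⟩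
    | succ k ih =>
      obtain ⟨δ, hδ, H⟩ := ih
      rcases Nat.eq_zero_or_pos k with rfl | hk
      · exact ⟨1, one_pos, fun d h0 h => by omega⟩
      refine ⟨min δ |k * y - round (k * y)|, lt_min hδ ?_, ?_⟩
      · rw [abs_pos, sub_ne_zero]
        have : Irrational ((k:ℝ) * y) := by
          have := hirr.natCast_mul hk.ne'
          exact this
        exact this.ne_int _
      · intro d h0 hd m
        rcases Nat.lt_succ_iff_lt_or_eq.1 hd with hd | rfl
        · exact (min_le_left _ _).trans (H d h0 hd m)
        · exact (min_le_right _ _).trans (round_le _ _)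
  obtain ⟨δ, hδ, H⟩ := h2
  obtain ⟨n2, hn2⟩ := exists_nat_gt (1 / δ)
  refine ⟨max n2 1, fun n hn => ?_⟩
  have hn' : 0 < n := by have := le_max_right n2 1; omega
  have hn2' : n2 ≤ n := (le_max_left _ _).trans hn
  obtain ⟨r, hr1, hr2⟩ := Real.exists_rat_abs_sub_le_and_den_le y hn'
  have hd : 0 < r.den := r.den_pos
  have hdR : (0:ℝ) < r.den := by exact_mod_cast hd
  have hnR : (0:ℝ) < n := by exact_mod_cast hn'
  have hr : (r:ℝ) = (r.num:ℝ) / r.den := by exact_mod_cast (Rat.num_div_den r).symm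
  rw [hr] at hr1
  have hdn : (r.den:ℝ) ≤ n := by exact_mod_cast hr2
  have hlt : |y - r.num / r.den| ≤ 1 / (n * r.den) := by
    refine hr1.trans ?_
    gcongr; linarith
  refine ⟨r.den, r.num, hd, hr2, ?_, ?_, ?_⟩
  · rcases lt_or_ge r.den n1 with hlt1 | hge
    · exfalso
      have h3 := H r.den hd hlt1 r.num
      have h4 : |(r.den:ℝ) * y - r.num| = r.den * |y - r.num / r.den| := by
        rw [← abs_of_pos hdR, ← abs_mul, abs_of_pos hdR]; congr 1; field_simp
      rw [h4] at h3
      have h5 : (r.den:ℝ) * |y - r.num / r.den| ≤ 1 / n := by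
        calc _ ≤ (r.den:ℝ) * (1 / (n * r.den)) := by gcongr
          _ = 1 / n := by field_simp
      have h6 : (1:ℝ) / δ < n := hn2.trans_le (by exact_mod_cast hn2')
      rw [div_lt_iff₀ hδ] at h6
      have h7 : δ ≤ 1 / n := h3.trans h5
      rw [le_div_iff₀ hnR] at h7
      linarith
    · have h3 := (hn1 r.den hge r.num).trans hlt
      have h4 : (n:ℝ) * r.den ≤ (r.den:ℝ) ^ (7/3:ℝ) := by
        rw [div_le_div_iff₀ (by positivity) (by positivity)] at h3; linarith
      have h5 : (r.den:ℝ) ^ (7/3:ℝ) = (r.den:ℝ)^(4/3:ℝ) * r.den := by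
        rw [show (7/3:ℝ) = 4/3 + 1 by norm_num, Real.rpow_add hdR, Real.rpow_one]
      rw [h5] at h4
      have h6 := le_of_mul_le_mul_right h4 hdR
      calc (n:ℝ)^(3/4:ℝ) ≤ ((r.den:ℝ)^(4/3:ℝ))^(3/4:ℝ) :=
            Real.rpow_le_rpow hnR.le h6 (by norm_num)
        _ = r.den := by rw [← Real.rpow_mul hdR.le]; norm_num
  · rw [Int.isCoprime_iff_gcd_eq_one]
    exact r.reduced
  · refine hlt.trans ?_
    gcongr
    rw [sq]; gcongr

theorem ae_dio : ∀ᵐ y : ℝ, Dio y := by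
  have h1 : ∀ᵐ y : ℝ, y ∉ Set.range ((↑) : ℚ → ℝ) :=
    (Set.countable_range _).ae_notMem _
  filter_upwards [h1, ae_not_liouvilleWith] with y hy hL
  exact dio_of hy (hL _ (by norm_num))

/-- Effective equidistribution at the point `y` with constant `C`. -/
def EqD (y C : ℝ) : Prop := 0 ≤ C ∧ ∀ (g v : ℝ → ℝ) (V : ℝ), BVP g v V → ∀ (φ : ℝ) (n : ℕ),
  |∑ j ∈ range n, g (φ + j * y) - n * ∫ x in (0:ℝ)..1, g x| ≤ C * V * (n:ℝ) ^ (1/4:ℝ)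

theorem eqD_of_dio {y : ℝ} (hy : Dio y) : ∃ C, EqD y C := by
  obtain ⟨n0, hn0⟩ := hy
  refine ⟨max n0 10, by positivity, fun g v V h φ n => ?_⟩
  set C : ℝ := max n0 10
  have hC0 : (n0:ℝ) ≤ C := le_max_left _ _
  have hC1 : (10:ℝ) ≤ C := le_max_right _ _
  have hV := h.V_nonneg
  induction n using Nat.strong_induction_on generalizing φ with
  | _ n ih =>
  rcases Nat.eq_zero_or_pos n with rfl | hn
  · simp
  have hnR : (1:ℝ) ≤ n := by exact_mod_cast hn
  rcases lt_or_ge n n0 with hlt | hge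
  · have h1 : |∑ j ∈ range n, g (φ + j * y) - n * ∫ x in (0:ℝ)..1, g x| ≤ n * V := by
      have : ∑ j ∈ range n, g (φ + j * y) - n * ∫ x in (0:ℝ)..1, g x
        = ∑ j ∈ range n, (g (φ + j * y) - ∫ x in (0:ℝ)..1, g x) := by simp
      rw [this]
      refine (Finset.abs_sum_le_sum_abs _ _).trans ?_
      refine (Finset.sum_le_sum fun j _ => h.mean _).trans ?_
      simp
    have h2 : (1:ℝ) ≤ (n:ℝ)^(1/4:ℝ) := Real.one_le_rpow hnR (by norm_num)
    have h3 : (n:ℝ) ≤ n0 := by exact_mod_cast hlt.le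
    calc _ ≤ (n:ℝ) * V := h1
      _ ≤ C * V * 1 := by rw [mul_one]; gcongr; linarith
      _ ≤ _ := by gcongr
  · obtain ⟨q, p, hq, hqn, hql, hco, hyq⟩ := hn0 n hge
    have hqR : (0:ℝ) < q := by exact_mod_cast hq
    set b := n / q
    set r := n % q
    have hbr : b * q + r = n := Nat.div_add_mod' n q
    have hrq : r < q := Nat.mod_lt _ hq
    have hb1 : 1 ≤ b := Nat.div_pos hqn hq
    have hqb : q ≤ b * q := Nat.le_mul_of_pos_left q hb1
    have hr2 : 2 * r ≤ n := by omega
    have h1 := dk_mul h q hq p hco y hyq φ b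
    have h2 := ih r (by omega) (φ + (b * q : ℕ) * y)
    have e : ∀ j : ℕ, φ + ((b * q + j : ℕ):ℝ) * y = φ + (b * q : ℕ) * y + j * y := by
      intro j; push_cast; ring
    have hsum : ∑ j ∈ range n, g (φ + j * y) = ∑ j ∈ range (b*q), g (φ + j * y)
        + ∑ j ∈ range r, g (φ + (b * q : ℕ) * y + j * y) := by
      conv_lhs => rw [← hbr]
      rw [Finset.sum_range_add]; simp only [e]
    have hnn : (n:ℝ) = (b * q : ℕ) + r := by exact_mod_cast hbr.symm
    set T := (n:ℝ)^(1/4:ℝ)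
    have hT : 0 ≤ T := by positivity
    have hb : (b:ℝ) ≤ T := by
      have h3 : (b:ℝ) * q ≤ n := by exact_mod_cast (by omega : b * q ≤ n)
      have h4 : (n:ℝ) = T * (n:ℝ)^(3/4:ℝ) := by
        simp only [T]
        rw [← Real.rpow_add (by linarith)]; norm_num
      have h5 : (b:ℝ) * q ≤ T * q := by
        calc _ ≤ (n:ℝ) := h3
          _ = T * (n:ℝ)^(3/4:ℝ) := h4
          _ ≤ _ := by gcongr
      exact le_of_mul_le_mul_right h5 hqR
    have hr : (r:ℝ)^(1/4:ℝ) ≤ 9/10 * T := by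
      have h3 : (r:ℝ) ≤ 1/2 * n := by
        have : (2:ℝ) * r ≤ n := by exact_mod_cast hr2
        linarith
      calc (r:ℝ)^(1/4:ℝ) ≤ (1/2 * (n:ℝ))^(1/4:ℝ) :=
            Real.rpow_le_rpow (by positivity) h3 (by norm_num)
        _ = (1/2:ℝ)^(1/4:ℝ) * T := Real.mul_rpow (by norm_num) (by positivity)
        _ ≤ ((9/10:ℝ)^(4:ℝ))^(1/4:ℝ) * T := by
            gcongr; norm_num
        _ = 9/10 * T := by rw [← Real.rpow_mul (by norm_num)]; norm_num
    have hfin : |∑ j ∈ range n, g (φ + j * y) - n * ∫ x in (0:ℝ)..1, g x| ≤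
        b * V + C * V * (r:ℝ)^(1/4:ℝ) := by
      rw [hsum, hnn]
      calc _ = |(∑ j ∈ range (b * q), g (φ + j * y) - (b * q : ℕ) * ∫ x in (0:ℝ)..1, g x)
        + (∑ j ∈ range r, g (φ + (b * q : ℕ) * y + j * y) - r * ∫ x in (0:ℝ)..1, g x)| := by
            congr 1; ring
        _ ≤ _ := (abs_add_le _ _).trans (add_le_add h1 h2)
    calc _ ≤ _ := hfin
      _ ≤ T * V + C * V * (9/10 * T) := by gcongr
      _ ≤ C * V * T := by nlinarith [mul_nonneg hV hT]

theorem ae_eqD : ∀ᵐ y : ℝ, ∃ C, EqD y C := ae_dio.mono fun _ h => eqD_of_dio h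

end Part2

section Part3
open MeasureTheory Filter Finset Real

section Prob
variable {Ω : Type*} [mΩ : MeasurableSpace Ω]

/-- first entrance sets -/
def fst (E : ℕ → Set Ω) (R : ℕ) : Set Ω := {ω | ω ∈ E R ∧ ∀ R' < R, ω ∉ E R'}

theorem fst_disj (E : ℕ → Set Ω) : Pairwise (Function.onFun Disjoint (fst E)) := by
  intro i j hij
  rw [Function.onFun, Set.disjoint_left]
  intro ω h1 h2
  rcases lt_or_gt_of_ne hij with h | h
  · exact h2.2 i h h1.1
  · exact h1.2 j h h2.1

theorem fst_meas {m : MeasurableSpace Ω} {E : ℕ → Set Ω} {R : ℕ}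
    (h : ∀ R' ≤ R, MeasurableSet[m] (E R')) : MeasurableSet[m] (fst E R) := by
  have : fst E R = E R ∩ ⋂ R' ∈ Finset.range R, (E R')ᶜ := by
    ext ω; simp [fst]
  rw [this]
  refine MeasurableSet.inter (h R le_rfl) ?_
  refine Finset.measurableSet_biInter _ fun R' hR' => ?_
  exact (h R' (Finset.mem_range.1 hR').le).compl

theorem exists_fst {E : ℕ → Set Ω} {R : ℕ} {ω : Ω} (h : ω ∈ E R) : ∃ R' ≤ R, ω ∈ fst E R' := by
  classical
  have hex : ∃ R, ω ∈ E R := ⟨R, h⟩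
  exact ⟨Nat.find hex, Nat.find_min' hex h, Nat.find_spec hex, fun R' hR' => Nat.find_min hex hR'⟩

theorem fst_union (E : ℕ → Set Ω) (N : ℕ) :
    ⋃ R ∈ Finset.range N, fst E R = ⋃ R ∈ Finset.range N, E R := by
  ext ω
  simp only [Set.mem_iUnion, Finset.mem_range]
  constructor
  · rintro ⟨R, hR, h⟩; exact ⟨R, hR, h.1⟩
  · rintro ⟨R, hR, h⟩
    obtain ⟨R', h1, h2⟩ := exists_fst h
    exact ⟨R', by omega, h2⟩

/-- Independent blocks. -/
structure Blk (μ : Measure Ω) (M : ℕ → MeasurableSpace Ω) : Prop where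
  le : ∀ r, M r ≤ mΩ
  ind : ProbabilityTheory.iIndep M μ

/-- sigma algebra generated by the blocks in a set. -/
def sig (M : ℕ → MeasurableSpace Ω) (S : Set ℕ) : MeasurableSpace Ω := ⨆ i ∈ S, M i

theorem sig_mono (M : ℕ → MeasurableSpace Ω) {S T : Set ℕ} (h : S ⊆ T) : sig M S ≤ sig M T :=
  biSup_mono fun _ hi => h hi

theorem le_sig (M : ℕ → MeasurableSpace Ω) {S : Set ℕ} {i : ℕ} (h : i ∈ S) : M i ≤ sig M S :=
  le_biSup M h

theorem Blk.sig_le {μ : Measure Ω} {M : ℕ → MeasurableSpace Ω} (h : Blk μ M) (S : Set ℕ) :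
    sig M S ≤ mΩ := iSup₂_le fun i _ => h.le i

theorem Blk.indep {μ : Measure Ω} {M : ℕ → MeasurableSpace Ω} (h : Blk μ M) {S T : Set ℕ}
    (hST : Disjoint S T) {A B : Set Ω} (hA : MeasurableSet[sig M S] A)
    (hB : MeasurableSet[sig M T] B) : μ (A ∩ B) = μ A * μ B :=
  (ProbabilityTheory.Indep_iff _ _ _).1
    (ProbabilityTheory.indep_iSup_of_disjoint h.le h.ind hST) A B hA hB

variable {μ : Measure Ω} {M : ℕ → MeasurableSpace Ω}

theorem fst_upper (h : Blk μ M) (E G : ℕ → Set Ω) (N : ℕ)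
    (hE : ∀ R, MeasurableSet[sig M (Set.Iic R)] (E R))
    (hG : ∀ R, MeasurableSet[sig M (Set.Ioi R)] (G R)) (q : ENNReal) (hq : ∀ R, μ (G R) ≤ q) :
    μ (⋃ R ∈ Finset.range N, (fst E R ∩ G R)) ≤ q * μ (⋃ R ∈ Finset.range N, E R) := by
  have hF : ∀ R, MeasurableSet[sig M (Set.Iic R)] (fst E R) := fun R =>
    fst_meas fun R' hR' => sig_mono M (Set.Iic_subset_Iic.2 hR') _ (hE R')
  rw [← fst_union E, measure_biUnion_finset (fun i _ j _ hij => fst_disj E hij)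
    (fun R _ => h.sig_le _ _ (hF R)), Finset.mul_sum]
  refine (measure_biUnion_finset_le _ _).trans (Finset.sum_le_sum fun R _ => ?_)
  rw [h.indep (Set.disjoint_left.2 fun x hx hx' => by simp at hx hx'; omega) (hF R) (hG R), mul_comm]
  gcongr
  exact hq R

theorem fst_lower (h : Blk μ M) (E G : ℕ → Set Ω) (N : ℕ)
    (hE : ∀ R, MeasurableSet[sig M (Set.Iio R)] (E R))
    (hG : ∀ R, MeasurableSet[sig M (Set.Ici R)] (G R)) (q : ENNReal) (hq : ∀ R, q ≤ μ (G R)) :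
    q * μ (⋃ R ∈ Finset.range N, E R) ≤ μ (⋃ R ∈ Finset.range N, (fst E R ∩ G R)) := by
  have hF : ∀ R, MeasurableSet[sig M (Set.Iio R)] (fst E R) := fun R =>
    fst_meas fun R' hR' => sig_mono M (Set.Iio_subset_Iio hR') _ (hE R')
  rw [← fst_union E, measure_biUnion_finset (fun i _ j _ hij => fst_disj E hij)
    (fun R _ => h.sig_le _ _ (hF R)), Finset.mul_sum, measure_biUnion_finset]
  · refine Finset.sum_le_sum fun R _ => ?_
    rw [h.indep (Set.disjoint_left.2 fun x hx hx' => by simp at hx hx'; omega) (hF R) (hG R), mul_comm]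
    gcongr
    exact hq R
  · intro i _ j _ hij
    exact (fst_disj E hij).mono Set.inter_subset_left Set.inter_subset_left
  · intro R _
    exact (h.sig_le _ _ (hF R)).inter (h.sig_le _ _ (hG R))

/-- Centered bounded variables adapted to the blocks. -/
structure Adp (μ : Measure Ω) (M : ℕ → MeasurableSpace Ω) (D : ℕ → Ω → ℝ) (v : ℝ) : Prop where
  meas : ∀ r, Measurable[M r] (D r)
  bdd : ∀ r, ∃ K, ∀ ω, |D r ω| ≤ K
  mean : ∀ r, ∫ ω, D r ω ∂μ = 0
  sq : ∀ r, ∫ ω, (D r ω) ^ 2 ∂μ ≤ v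

theorem Adp.memLp [IsProbabilityMeasure μ] (h : Blk μ M) {D : ℕ → Ω → ℝ} {v : ℝ}
    (hD : Adp μ M D v) (r : ℕ) : MemLp (D r) 2 μ := by
  obtain ⟨K, hK⟩ := hD.bdd r
  have hm : Measurable (D r) := (hD.meas r).mono (h.le r) le_rfl
  exact MemLp.of_bound hm.aestronglyMeasurable K (Eventually.of_forall hK)

theorem Adp.var_le [IsProbabilityMeasure μ] (h : Blk μ M) {D : ℕ → Ω → ℝ} {v : ℝ}
    (hD : Adp μ M D v) (r : ℕ) : ProbabilityTheory.variance (D r) μ ≤ v := by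
  have hm : Measurable (D r) := (hD.meas r).mono (h.le r) le_rfl
  rw [ProbabilityTheory.variance_of_integral_eq_zero hm.aemeasurable (hD.mean r)]
  exact hD.sq r

theorem Adp.cheb [IsProbabilityMeasure μ] (h : Blk μ M) {D : ℕ → Ω → ℝ} {v : ℝ}
    (hD : Adp μ M D v) (r : ℕ) {a : ℝ} (ha : 0 < a) :
    μ {ω | a < |D r ω|} ≤ ENNReal.ofReal (v / a ^ 2) := by
  have := ProbabilityTheory.meas_ge_le_variance_div_sq (hD.memLp h r) ha
  simp only [hD.mean r, sub_zero] at this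
  refine (measure_mono ?_).trans (this.trans ?_)
  · intro ω hω; exact le_of_lt (Set.mem_setOf_eq ▸ hω)
  · apply ENNReal.ofReal_le_ofReal
    gcongr
    exact hD.var_le h r

/-- Partial sums. -/
def psum (D : ℕ → Ω → ℝ) (s R : ℕ) (ω : Ω) : ℝ := ∑ r ∈ Finset.Ico s R, D r ω

theorem psum_cheb [IsProbabilityMeasure μ] (h : Blk μ M) {D : ℕ → Ω → ℝ} {v : ℝ}
    (hD : Adp μ M D v) (s N : ℕ) {a : ℝ} (ha : 0 < a) (hv : 0 ≤ v) :
    μ {ω | a < |psum D s N ω|} ≤ ENNReal.ofReal (N * v / a ^ 2) := by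
  have e : psum D s N = ∑ r ∈ Finset.Ico s N, D r := by
    funext ω; simp [psum]
  have hL : MemLp (psum D s N) 2 μ := by
    rw [e]; exact memLp_finsetSum' _ fun r _ => hD.memLp h r
  have hmean : ∫ ω, psum D s N ω ∂μ = 0 := by
    simp only [psum]
    rw [integral_finsetSum _ fun r _ => (hD.memLp h r).integrable (by norm_num)]
    simp [hD.mean]
  have hvar : ProbabilityTheory.variance (psum D s N) μ ≤ N * v := by
    rw [e, ProbabilityTheory.IndepFun.variance_sum (fun r _ => hD.memLp h r)]
    · refine (Finset.sum_le_sum fun r _ => hD.var_le h r).trans ?_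
      rw [Finset.sum_const, nsmul_eq_mul, Nat.card_Ico]
      gcongr; omega
    · intro i _ j _ hij
      rw [ProbabilityTheory.IndepFun_iff_Indep]
      have := h.ind.indep hij
      exact ProbabilityTheory.indep_of_indep_of_le_left
        (ProbabilityTheory.indep_of_indep_of_le_right this (hD.meas j).comap_le) (hD.meas i).comap_le
  have := ProbabilityTheory.meas_ge_le_variance_div_sq hL ha
  simp only [hmean, sub_zero] at this
  refine (measure_mono ?_).trans (this.trans ?_)
  · intro ω hω; exact le_of_lt (Set.mem_setOf_eq ▸ hω)
  · apply ENNReal.ofReal_le_ofReal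
    gcongr

theorem psum_meas {D : ℕ → Ω → ℝ} {v : ℝ}
    (hD : Adp μ M D v) (s R : ℕ) : Measurable[sig M (Set.Ico s R)] (psum D s R) := by
  unfold psum
  refine Finset.measurable_sum _ fun r hr => ?_
  have := Finset.mem_Ico.1 hr
  exact (hD.meas r).mono (le_sig M this) le_rfl

theorem psum_abs_meas {D : ℕ → Ω → ℝ} {v : ℝ}
    (hD : Adp μ M D v) (s R : ℕ) (a : ℝ) :
    MeasurableSet[sig M (Set.Ico s R)] {ω | a < |psum D s R ω|} := by
  have h := @Measurable.comp _ _ _ (sig M (Set.Ico s R)) _ _ _ _ (measurable_norm (α := ℝ))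
    (psum_meas hD s R)
  exact h measurableSet_Ioi

theorem ottaviani [IsProbabilityMeasure μ] (h : Blk μ M) {D : ℕ → Ω → ℝ} {v : ℝ}
    (hD : Adp μ M D v) (s N : ℕ) {a : ℝ} (ha : 0 < a) (hv : 0 ≤ v) :
    μ (⋃ R ∈ Finset.range N, {ω | s ≤ R ∧ 2 * a < |psum D s R ω|})
      ≤ ENNReal.ofReal (2 * (N * v / a ^ 2)) := by
  set t := N * v / a ^ 2 with ht
  have ht0 : 0 ≤ t := by positivity
  rcases le_or_gt t (1/2) with hle | hgt
  · set E : ℕ → Set Ω := fun R => {ω | s ≤ R ∧ 2 * a < |psum D s R ω|} with hE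
    set G : ℕ → Set Ω := fun R => {ω | a < |psum D R N ω|}ᶜ with hG
    have hEm : ∀ R, MeasurableSet[sig M (Set.Iio R)] (E R) := by
      intro R
      have h1 := sig_mono M (Set.Ico_subset_Iio_self : Set.Ico s R ⊆ Set.Iio R) _
        (psum_abs_meas hD s R (2 * a))
      exact MeasurableSet.inter (@MeasurableSet.const _ (sig M (Set.Iio R)) (s ≤ R)) h1
    have hGm : ∀ R, MeasurableSet[sig M (Set.Ici R)] (G R) := by
      intro R
      have h1 := sig_mono M (Set.Ico_subset_Ici_self : Set.Ico R N ⊆ Set.Ici R) _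
        (psum_abs_meas hD R N a)
      exact MeasurableSet.compl h1
    have hGq : ∀ R, (2:ENNReal)⁻¹ ≤ μ (G R) := by
      intro R
      have h1 := psum_cheb h hD R N ha hv
      have h2 : μ {ω | a < |psum D R N ω|} ≤ (2:ENNReal)⁻¹ := by
        refine h1.trans ?_
        have : (2:ENNReal)⁻¹ = ENNReal.ofReal (1/2) := by
          rw [one_div, ENNReal.ofReal_inv_of_pos (by norm_num)]; simp
        rw [this]; exact ENNReal.ofReal_le_ofReal hle
      have hm : MeasurableSet {ω | a < |psum D R N ω|} := h.sig_le _ _ (psum_abs_meas hD R N a)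
      simp only [hG]
      rw [prob_compl_eq_one_sub hm]
      calc (2:ENNReal)⁻¹ = 1 - 2⁻¹ := by
            exact ENNReal.one_sub_inv_two.symm
        _ ≤ _ := by gcongr
    have h3 := fst_lower h E G N hEm hGm _ hGq
    have h4 : μ (⋃ R ∈ Finset.range N, (fst E R ∩ G R)) ≤ ENNReal.ofReal t := by
      refine (measure_mono ?_).trans (psum_cheb h hD s N ha hv)
      intro ω hω
      simp only [Set.mem_iUnion, Finset.mem_range] at hω
      obtain ⟨R, hR, ⟨⟨hsR, h5⟩, -⟩, h6⟩ := hω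
      have h6' : |psum D R N ω| ≤ a := not_lt.1 h6
      have h7 : psum D s N ω = psum D s R ω + psum D R N ω := by
        simp only [psum]; exact (Finset.sum_Ico_consecutive _ hsR hR.le).symm
      have : |psum D s R ω| ≤ |psum D s N ω| + |psum D R N ω| := by
        have : psum D s R ω = psum D s N ω - psum D R N ω := by rw [h7]; ring
        rw [this]; exact abs_sub _ _
      show a < |psum D s N ω|
      linarith
    have h8 := h3.trans h4
    rw [ENNReal.ofReal_mul (by norm_num)]
    calc μ (⋃ R ∈ Finset.range N, E R) = 2 * (2⁻¹ * μ (⋃ R ∈ Finset.range N, E R)) := by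
          rw [← mul_assoc, ENNReal.mul_inv_cancel (by norm_num) (by norm_num), one_mul]
      _ ≤ _ := by
          simp only [ENNReal.ofReal_ofNat]
          gcongr
  · refine prob_le_one.trans ?_
    rw [← ENNReal.ofReal_one]
    exact ENNReal.ofReal_le_ofReal (by linarith)

/-- crossing at step `R` starting from `s`. -/
def crs (X : ℕ → ℕ → Ω → ℝ) (I : ℕ) (b : ℝ) (s R : ℕ) : Set Ω :=
  {ω | s ≤ R ∧ ∃ i ∈ Finset.range (I + 1), b < |psum (fun r => X r I) s R ω + X R i ω|}

theorem crs_meas {X : ℕ → ℕ → Ω → ℝ} {v : ℝ} {I : ℕ}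
    (hX : ∀ i, Adp μ M (fun r => X r i) v) (b : ℝ) (s R : ℕ) {S : Set ℕ} (hS : Set.Icc s R ⊆ S) :
    MeasurableSet[sig M S] (crs X I b s R) := by
  by_cases hsR : s ≤ R
  swap
  · have : crs X I b s R = ∅ := by ext ω; simp [crs, hsR]
    rw [this]; exact @MeasurableSet.empty _ (sig M S)
  have : crs X I b s R = ⋃ i ∈ Finset.range (I + 1),
      {ω | b < |psum (fun r => X r I) s R ω + X R i ω|} := by
    ext ω; simp [crs, hsR]
  rw [this]
  refine Finset.measurableSet_biUnion _ fun i _ => ?_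
  have h1 : Measurable[sig M S] (psum (fun r => X r I) s R) :=
    (psum_meas (hX I) s R).mono (sig_mono M (Set.Ico_subset_Icc_self.trans hS)) le_rfl
  have h2 : Measurable[sig M S] (X R i) :=
    ((hX i).meas R).mono (le_sig M (hS ⟨hsR, le_rfl⟩)) le_rfl
  have h3 := @Measurable.add _ _ _ _ (sig M S) (psum (fun r => X r I) s R) (X R i) _ h1 h2
  have h4 := @Measurable.comp _ _ _ (sig M S) _ _ _ _ (measurable_norm (α := ℝ)) h3
  exact h4 measurableSet_Ioi

theorem crs_prob [IsProbabilityMeasure μ] (h : Blk μ M) {X : ℕ → ℕ → Ω → ℝ} {v : ℝ} {I : ℕ}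
    (hX : ∀ i, Adp μ M (fun r => X r i) v) (s N : ℕ) {a : ℝ} (ha : 0 < a) (hv : 0 ≤ v) :
    μ (⋃ R ∈ Finset.range N, crs X I (4 * a) s R) ≤ ENNReal.ofReal ((I + 3) * (N * v / a ^ 2)) := by
  have hsub : (⋃ R ∈ Finset.range N, crs X I (4 * a) s R) ⊆
      (⋃ R ∈ Finset.range N, {ω | s ≤ R ∧ 2 * a < |psum (fun r => X r I) s R ω|}) ∪
      ⋃ R ∈ Finset.range N, ⋃ i ∈ Finset.range (I + 1), {ω | a < |X R i ω|} := by
    intro ω hω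
    simp only [Set.mem_iUnion] at hω
    obtain ⟨R, hR, hs, i, hi, hlt⟩ := hω
    by_cases h1 : 2 * a < |psum (fun r => X r I) s R ω|
    · left
      simp only [Set.mem_iUnion]
      exact ⟨R, hR, hs, h1⟩
    · right
      simp only [Set.mem_iUnion]
      refine ⟨R, hR, i, hi, ?_⟩
      have := abs_add_le (psum (fun r => X r I) s R ω) (X R i ω)
      show a < |X R i ω|
      linarith
  refine (measure_mono hsub).trans ((measure_union_le _ _).trans ?_)
  have h1 := ottaviani h (hX I) s N ha hv
  have h2 : μ (⋃ R ∈ Finset.range N, ⋃ i ∈ Finset.range (I + 1), {ω | a < |X R i ω|}) ≤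
      ENNReal.ofReal ((I + 1) * (N * v / a ^ 2)) := by
    refine (measure_biUnion_finset_le _ _).trans ?_
    refine (Finset.sum_le_sum fun R _ => (measure_biUnion_finset_le _ _).trans
      (Finset.sum_le_sum fun i _ => (hX i).cheb h R ha)).trans ?_
    simp only [Finset.sum_const, Finset.card_range, nsmul_eq_mul]
    rw [← ENNReal.ofReal_natCast, ← ENNReal.ofReal_natCast, ← ENNReal.ofReal_mul (by positivity),
      ← ENNReal.ofReal_mul (by positivity)]
    apply ENNReal.ofReal_le_ofReal
    apply le_of_eq; push_cast; ring
  refine (add_le_add h1 h2).trans ?_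
  rw [← ENNReal.ofReal_add (by positivity) (by positivity)]
  apply ENNReal.ofReal_le_ofReal
  apply le_of_eq; ring

/-- The event that the walk crosses twice. -/
def notGood (X : ℕ → ℕ → Ω → ℝ) (I N : ℕ) (b : ℝ) : Set Ω :=
  ⋃ R ∈ Finset.range N, (fst (crs X I b 0) R ∩ ⋃ R' ∈ Finset.range N, crs X I b (R + 1) R')

theorem notGood_prob [IsProbabilityMeasure μ] (h : Blk μ M) {X : ℕ → ℕ → Ω → ℝ} {v : ℝ} {I : ℕ}
    (hX : ∀ i, Adp μ M (fun r => X r i) v) (N : ℕ) {a : ℝ} (ha : 0 < a) (hv : 0 ≤ v) :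
    μ (notGood X I N (4 * a)) ≤ ENNReal.ofReal (((I + 3) * (N * v / a ^ 2)) ^ 2) := by
  have := fst_upper h (crs X I (4 * a) 0)
    (fun R => ⋃ R' ∈ Finset.range N, crs X I (4 * a) (R + 1) R') N
    (fun R => crs_meas hX _ _ _ (fun x hx => hx.2)) ?_ _
    (fun R => crs_prob h hX (R + 1) N ha hv)
  · refine this.trans ?_
    have e : ∀ t : ℝ, 0 ≤ t → ENNReal.ofReal (t ^ 2) = ENNReal.ofReal t * ENNReal.ofReal t := by
      intro t ht; rw [sq, ENNReal.ofReal_mul ht]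
    rw [e _ (by positivity)]
    exact mul_le_mul_right (crs_prob h hX 0 N ha hv) _
  · intro R
    refine Finset.measurableSet_biUnion _ fun R' _ => ?_
    exact crs_meas hX _ _ _ (fun x hx => Set.mem_Ioi.2 (Nat.lt_of_succ_le hx.1))

theorem good_struct {X : ℕ → ℕ → Ω → ℝ} {I N : ℕ} {b : ℝ} {ω : Ω} (hω : ω ∉ notGood X I N b) :
    ∃ σ ≤ N, (∀ R < σ, ∀ i ≤ I, |psum (fun r => X r I) 0 R ω + X R i ω| ≤ b) ∧
      (∀ R < N, σ < R → ∀ i ≤ I, |psum (fun r => X r I) (σ + 1) R ω + X R i ω| ≤ b) := by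
  by_cases hc : ∃ R < N, ω ∈ crs X I b 0 R
  · obtain ⟨R, hR, hcr⟩ := hc
    obtain ⟨σ, hσ, hf⟩ := exists_fst hcr
    refine ⟨σ, by omega, ?_, ?_⟩
    · intro R' hR' i hi
      have := hf.2 R' hR'
      by_contra hcon
      exact this ⟨Nat.zero_le _, i, Finset.mem_range.2 (by omega), not_le.1 hcon⟩
    · intro R' hR' hσR i hi
      by_contra hcon
      apply hω
      simp only [notGood, Set.mem_iUnion]
      refine ⟨σ, Finset.mem_range.2 (by omega), hf, ?_⟩
      simp only [Set.mem_iUnion]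
      exact ⟨R', Finset.mem_range.2 hR', hσR, i, Finset.mem_range.2 (by omega), not_le.1 hcon⟩
  · push Not at hc
    refine ⟨N, le_rfl, ?_, fun R h1 h2 => by omega⟩
    intro R hR i hi
    by_contra hcon
    exact hc R hR ⟨Nat.zero_le _, i, Finset.mem_range.2 (by omega), not_le.1 hcon⟩

end Prob

end Part3

section Part4
open MeasureTheory Filter Finset Real

/-- uniform measure on the unit interval -/
noncomputable def uni : Measure ℝ := volume.restrict (Set.Ioc 0 1)

instance : IsProbabilityMeasure uni := ⟨by simp [uni]⟩

theorem uni_int (g : ℝ → ℝ) : ∫ x, g x ∂uni = ∫ x in (0:ℝ)..1, g x := by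
  rw [intervalIntegral.integral_of_le zero_le_one, uni]

theorem uni_shift {g : ℝ → ℝ} (hper : ∀ x, g (x + 1) = g x) (c : ℝ) :
    ∫ x, g (c + x) ∂uni = ∫ x, g x ∂uni := by
  rw [uni_int, uni_int, intervalIntegral.integral_comp_add_left]
  have h : Function.Periodic g 1 := hper
  have := h.intervalIntegral_add_eq c 0
  simpa using this

theorem uni_scale {g : ℝ → ℝ} (hper : ∀ x, g (x + 1) = g x) (hm : Measurable g)
    {K : ℝ} (hK : ∀ x, |g x| ≤ K)
    (h0 : ∫ x, g x ∂uni = 0) (n : ℤ) (hn : n ≠ 0) (c : ℝ) :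
    ∫ x, g (n * x + c) ∂uni = 0 := by
  have hn' : (n:ℝ) ≠ 0 := by exact_mod_cast hn
  rw [uni_int] at *
  rw [intervalIntegral.integral_comp_mul_add _ hn']
  have h : Function.Periodic g 1 := hper
  have hi : ∀ a b, IntervalIntegrable g volume a b := by
    intro a b
    refine IntervalIntegrable.mono_fun (g := g) (f := fun _ => K) intervalIntegrable_const
      hm.aestronglyMeasurable (Eventually.of_forall fun x => ?_)
    show |g x| ≤ |K|
    exact (hK x).trans (le_abs_self _)
  have h1 := h.intervalIntegral_add_zsmul_eq n c (fun a b => hi a b)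
  have h2 := h.intervalIntegral_add_eq c 0
  simp only [zero_add] at h2
  rw [h2, h0] at h1
  simp only [zsmul_eq_mul, mul_one, mul_zero, zero_add] at h1 ⊢
  rw [add_comm (n:ℝ) c, h1]; simp

/-- law of one block -/
noncomputable def blk : Measure (ℝ × ℝ) := uni.prod uni

instance : IsProbabilityMeasure blk := by unfold blk; infer_instance

section One

theorem blk_integrable {g : ℝ → ℝ} (hper : ∀ x, g (x + 1) = g x) (hm : Measurable g) (hK : ∀ x, |g x| ≤ 1)
    (h0 : ∫ x, g x ∂uni = 0) {G : ℝ × ℝ → ℝ} (hG : Measurable G) {K : ℝ} (hb : ∀ p, |G p| ≤ K) :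
    Integrable G blk :=
  Integrable.of_bound hG.aestronglyMeasurable K (Eventually.of_forall hb)

theorem blk_mean {g : ℝ → ℝ} (hper : ∀ x, g (x + 1) = g x) (hm : Measurable g) (hK : ∀ x, |g x| ≤ 1)
    (h0 : ∫ x, g x ∂uni = 0) (j : ℕ) : ∫ p, g (j * p.1 + p.2) ∂blk = 0 := by
  have hme : Measurable (fun p : ℝ × ℝ => g (j * p.1 + p.2)) := by fun_prop
  unfold blk
  rw [integral_prod _ (blk_integrable hper hm hK h0 hme (K := 1) fun p => hK _)]
  simp [uni_shift hper, h0]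

theorem blk_orth {g : ℝ → ℝ} (hper : ∀ x, g (x + 1) = g x) (hm : Measurable g) (hK : ∀ x, |g x| ≤ 1)
    (h0 : ∫ x, g x ∂uni = 0) {j k : ℕ} (hjk : j ≠ k) :
    ∫ p, g (j * p.1 + p.2) * g (k * p.1 + p.2) ∂blk = 0 := by
  have hb : ∀ a b, |g a * g b| ≤ 1 := fun a b => by
    rw [abs_mul]; exact mul_le_one₀ (hK _) (abs_nonneg _) (hK _)
  have hme : Measurable (fun p : ℝ × ℝ => g (j * p.1 + p.2) * g (k * p.1 + p.2)) := by fun_prop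
  unfold blk
  rw [integral_prod _ (blk_integrable hper hm hK h0 hme fun p => hb _ _)]
  have e : ∀ z : ℝ, ∫ θ, g (j * z + θ) * g (k * z + θ) ∂uni
      = ∫ θ, g θ * g (((k:ℤ) - j : ℤ) * z + θ) ∂uni := by
    intro z
    have := uni_shift (g := fun θ => g θ * g (((k:ℤ) - j : ℤ) * z + θ))
      (fun x => by simp only [hper, ← add_assoc]) (j * z)
    rw [← this]
    congr 1; funext θ; congr 2; push_cast; ring
  simp only [e]
  have hme2 : Measurable (fun p : ℝ × ℝ => g p.2 * g (((k:ℤ) - j : ℤ) * p.1 + p.2)) := by fun_prop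
  have hi2 : Integrable (Function.uncurry fun z θ : ℝ => g θ * g (((k:ℤ) - j : ℤ) * z + θ))
      (uni.prod uni) := blk_integrable hper hm hK h0 hme2 fun p => hb _ _
  rw [integral_integral_swap hi2]
  simp only [integral_const_mul]
  simp [uni_scale hper hm hK h0 ((k:ℤ) - j) (by omega), -Int.cast_sub]

theorem blk_sum_mean {g : ℝ → ℝ} (hper : ∀ x, g (x + 1) = g x) (hm : Measurable g) (hK : ∀ x, |g x| ≤ 1)
    (h0 : ∫ x, g x ∂uni = 0) (c : ℕ → ℝ) (n : ℕ) :
    ∫ p, ∑ j ∈ range n, g (j * p.1 + p.2) * c j ∂blk = 0 := by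
  rw [integral_finsetSum]
  · simp only [integral_mul_const, blk_mean hper hm hK h0]; simp
  · intro j _
    refine Integrable.mul_const ?_ _
    exact blk_integrable hper hm hK h0 (by fun_prop) (K := 1) fun p => hK _

theorem blk_sum_sq {g : ℝ → ℝ} (hper : ∀ x, g (x + 1) = g x) (hm : Measurable g) (hK : ∀ x, |g x| ≤ 1)
    (h0 : ∫ x, g x ∂uni = 0) (c : ℕ → ℝ) (n : ℕ) {F : ℝ} (hc : ∀ j, |c j| ≤ F) :
    ∫ p, (∑ j ∈ range n, g (j * p.1 + p.2) * c j) ^ 2 ∂blk ≤ n * F ^ 2 := by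
  have hb : ∀ a b, |g a * g b| ≤ 1 := fun a b => by
    rw [abs_mul]; exact mul_le_one₀ (hK _) (abs_nonneg _) (hK _)
  have hi : ∀ j k : ℕ, Integrable (fun p : ℝ × ℝ => g (j * p.1 + p.2) * g (k * p.1 + p.2)) blk :=
    fun j k => blk_integrable hper hm hK h0 (by fun_prop) fun p => hb _ _
  have e : ∀ p : ℝ × ℝ, (∑ j ∈ range n, g (j * p.1 + p.2) * c j) ^ 2 =
      ∑ j ∈ range n, ∑ k ∈ range n, (g (j * p.1 + p.2) * g (k * p.1 + p.2)) * (c j * c k) := by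
    intro p
    rw [sq, Finset.sum_mul_sum]
    refine Finset.sum_congr rfl fun j _ => Finset.sum_congr rfl fun k _ => by ring
  simp only [e]
  rw [integral_finsetSum _ fun j _ => integrable_finsetSum _ fun k _ => (hi j k).mul_const _]
  have : ∀ j ∈ range n, ∫ p, ∑ k ∈ range n, (g (j * p.1 + p.2) * g (k * p.1 + p.2)) * (c j * c k) ∂blk
      ≤ F ^ 2 := by
    intro j hj
    rw [integral_finsetSum _ fun k _ => (hi j k).mul_const _]
    rw [Finset.sum_eq_single_of_mem j hj]
    · rw [integral_mul_const]
      have h1 : ∫ p : ℝ × ℝ, g (j * p.1 + p.2) * g (j * p.1 + p.2) ∂blk ≤ 1 := by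
        calc _ ≤ ∫ p : ℝ × ℝ, (1:ℝ) ∂blk := by
              refine integral_mono (hi j j) (integrable_const _) fun p => ?_
              exact (le_abs_self _).trans (hb _ _)
          _ = 1 := by simp
      have h2 : 0 ≤ c j * c j := mul_self_nonneg _
      have h3 : c j * c j ≤ F ^ 2 := by
        rw [← sq, ← sq_abs]; exact pow_le_pow_left₀ (abs_nonneg _) (hc j) 2
      calc _ ≤ 1 * (c j * c j) := by gcongr
        _ ≤ _ := by linarith
    · intro k _ hk
      rw [integral_mul_const, blk_orth hper hm hK h0 hk.symm, zero_mul]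
  refine (Finset.sum_le_sum this).trans ?_
  simp
end One

/-- probability that the fractional part is small. -/
theorem uni_fract (y : ℝ) {t : ℝ} (ht1 : t ≤ 1) :
    ENNReal.ofReal t ≤ uni {z | Int.fract (z - y) < t} := by
  set A : Set ℝ := {z | Int.fract (z - y) < t} with hA
  have hAm : MeasurableSet A := by
    have : Measurable fun z : ℝ => Int.fract (z - y) := by fun_prop
    exact measurableSet_lt this measurable_const
  rw [uni, Measure.restrict_apply hAm]
  have h1 := (isAddFundamentalDomain_Ioc (T := (1:ℝ)) one_pos 0 volume).measure_set_eq
    (isAddFundamentalDomain_Ioc (T := (1:ℝ)) one_pos y volume) hAm ?_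
  · simp only [zero_add] at h1
    rw [h1]
    have h2 : Set.Ioo y (y + t) ⊆ A ∩ Set.Ioc y (y + 1) := by
      intro z hz
      refine ⟨?_, hz.1, by linarith [hz.2]⟩
      have : Int.fract (z - y) = z - y := Int.fract_eq_self.2 ⟨by linarith [hz.1], by linarith [hz.2]⟩
      show Int.fract (z - y) < t
      rw [this]; linarith [hz.2]
    calc ENNReal.ofReal t = volume (Set.Ioo y (y + t)) := by simp
      _ ≤ _ := measure_mono h2
  · rintro ⟨g, hg⟩
    obtain ⟨n, rfl⟩ := AddSubgroup.mem_zmultiples_iff.1 hg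
    ext z
    simp only [hA, Set.mem_preimage, Set.mem_ofPred_eq]
    have : (⟨n • (1:ℝ), hg⟩ : AddSubgroup.zmultiples (1:ℝ)) +ᵥ z = n + z := by
      show n • (1:ℝ) + z = n + z
      simp
    rw [this, show (n:ℝ) + z - y = n + (z - y) by ring, Int.fract_intCast_add]

theorem blk_peak (y φ : ℝ) {s t : ℝ} (hs : s ≤ 1) (ht : t ≤ 1) :
    ENNReal.ofReal s * ENNReal.ofReal t ≤
      blk {p | Int.fract (p.1 - y) < s ∧ Int.fract (p.2 - φ) < t} := by
  have : {p : ℝ × ℝ | Int.fract (p.1 - y) < s ∧ Int.fract (p.2 - φ) < t} =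
      {z | Int.fract (z - y) < s} ×ˢ {z | Int.fract (z - φ) < t} := by
    ext p; simp
  rw [this, blk, Measure.prod_prod]
  exact mul_le_mul' (uni_fract y hs) (uni_fract φ ht)

end Part4

section Part5
open MeasureTheory Filter Finset Real

/-- indicator of positivity -/
noncomputable def psi (f : ℝ → ℝ) (x : ℝ) : ℝ := if 0 < f x then 1 else 0

/-- centered partial block sums -/
noncomputable def dd (f : ℝ → ℝ) (ρ y : ℝ) (Y Δ : ℕ) (R : ℕ) (n : ℕ) (p : ℝ × ℝ) : ℝ :=
  ∑ j ∈ range n, (psi f (j * p.1 + p.2) - ρ) * f (((Y:ℝ) + R * Δ) * y + j * y)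

/-- stage sums -/
noncomputable def St (f : ℝ → ℝ) (y : ℝ) (Y Δ : ℕ) (q : ℕ → ℝ × ℝ) (t : ℕ) : ℝ :=
  ∑ j ∈ range t, psi f (((j % Δ : ℕ) : ℝ) * (q (j / Δ)).1 + (q (j / Δ)).2) * f (((Y:ℝ) + j) * y)

theorem psi_nonneg (f : ℝ → ℝ) (x : ℝ) : 0 ≤ psi f x := by unfold psi; split_ifs <;> norm_num
theorem psi_le_one (f : ℝ → ℝ) (x : ℝ) : psi f x ≤ 1 := by unfold psi; split_ifs <;> norm_num

theorem St_decomp (f : ℝ → ℝ) (ρ y : ℝ) (Y Δ : ℕ) (hΔ : 0 < Δ) (q : ℕ → ℝ × ℝ) (R n : ℕ) (hn : n ≤ Δ) :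
    St f y Y Δ q (R * Δ + n) = ∑ r ∈ range R, dd f ρ y Y Δ r Δ (q r) + dd f ρ y Y Δ R n (q R)
      + ρ * ∑ j ∈ range (R * Δ + n), f (Y * y + j * y) := by
  have key : ∀ R n, n ≤ Δ → St f y Y Δ q (R * Δ + n) = St f y Y Δ q (R * Δ) + dd f ρ y Y Δ R n (q R)
      + ρ * ∑ j ∈ range n, f (Y * y + (R * Δ + j : ℕ) * y) := by
    intro R n hn
    unfold St dd
    rw [Finset.sum_range_add, add_assoc, Finset.mul_sum, ← Finset.sum_add_distrib]
    congr 1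
    refine Finset.sum_congr rfl fun j hj => ?_
    have hj' : j < Δ := (Finset.mem_range.1 hj).trans_le hn
    have e1 : (R * Δ + j) % Δ = j := by
      rw [Nat.mul_add_mod_self_right, Nat.mod_eq_of_lt hj']
    have e2 : (R * Δ + j) / Δ = R := by
      rw [mul_comm, Nat.mul_add_div hΔ, Nat.div_eq_of_lt hj', add_zero]
    rw [e1, e2]
    push_cast
    rw [show ((Y:ℝ) + (R * Δ + j)) * y = (Y + R * Δ) * y + j * y by ring,
      show (Y:ℝ) * y + (R * Δ + j) * y = (Y + R * Δ) * y + j * y by ring]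
    ring
  have key2 : ∀ R, St f y Y Δ q (R * Δ) = ∑ r ∈ range R, dd f ρ y Y Δ r Δ (q r)
      + ρ * ∑ j ∈ range (R * Δ), f (Y * y + j * y) := by
    intro R
    induction R with
    | zero => simp [St]
    | succ R ih =>
      rw [Nat.succ_mul, key R Δ le_rfl, ih, Finset.sum_range_succ, Finset.sum_range_add]
      ring
  rw [key R n hn, key2, Finset.sum_range_add]
  ring

section Det
variable {f v : ℝ → ℝ} {V : ℝ}

theorem int_neg_part (h : BVP f v V) (h0 : ∫ x in (0:ℝ)..1, f x = 0) :
    ∫ x in (0:ℝ)..1, max (-f x) 0 = ∫ x in (0:ℝ)..1, max (f x) 0 := by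
  have e : ∀ x, max (-f x) 0 = max (f x) 0 - f x := by
    intro x
    rcases le_total 0 (f x) with h | h
    · rw [max_eq_right (by linarith), max_eq_left h]; ring
    · rw [max_eq_left (by linarith), max_eq_right h]; ring
  simp only [e]
  rw [intervalIntegral.integral_sub (h.pos_part.ii 0 1) (h.ii 0 1), h0, sub_zero]

theorem rp_mono {a b : ℝ} (ha : 0 ≤ a) (h : a ≤ b) : a ^ (1/4:ℝ) ≤ b ^ (1/4:ℝ) :=
  Real.rpow_le_rpow ha h (by norm_num)

theorem dd_bound (h : BVP f v V) (h0 : ∫ x in (0:ℝ)..1, f x = 0) {y C : ℝ} (hC : EqD y C)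
    {ρ : ℝ} (hρ0 : 0 ≤ ρ) (hρ1 : ρ ≤ 1) (Y Δ R n : ℕ) (hn : n ≤ Δ) (p : ℝ × ℝ) :
    |dd f ρ y Y Δ R n p| ≤ (∫ x in (0:ℝ)..1, max (f x) 0) * Δ + C * V * (Δ:ℝ) ^ (1/4:ℝ) := by
  set H := ∫ x in (0:ℝ)..1, max (f x) 0 with hH
  have hH0 : 0 ≤ H := intervalIntegral.integral_nonneg zero_le_one fun x _ => le_max_right _ _
  have h1 := (abs_le.1 (hC.2 _ v V h.pos_part (((Y:ℝ) + R * Δ) * y) n)).2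
  have h2 := (abs_le.1 (hC.2 _ v V h.neg.pos_part (((Y:ℝ) + R * Δ) * y) n)).2
  rw [int_neg_part h h0] at h2
  have hCV : 0 ≤ C * V := mul_nonneg hC.1 h.V_nonneg
  have hn' : (n:ℝ) ≤ Δ := by exact_mod_cast hn
  have h3 : C * V * (n:ℝ) ^ (1/4:ℝ) ≤ C * V * (Δ:ℝ) ^ (1/4:ℝ) :=
    mul_le_mul_of_nonneg_left (rp_mono (by positivity) hn') hCV
  have h4 : n * H ≤ H * Δ := by rw [mul_comm]; exact mul_le_mul_of_nonneg_left hn' hH0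
  set Bd := H * Δ + C * V * (Δ:ℝ) ^ (1/4:ℝ) with hBd
  rw [← hH] at h1 h2
  set P := ∑ j ∈ range n, max (f (((Y:ℝ) + R * Δ) * y + j * y)) 0 with hP
  set Q := ∑ j ∈ range n, max (-f (((Y:ℝ) + R * Δ) * y + j * y)) 0 with hQ
  have hPB : P ≤ Bd := by linarith
  have hQB : Q ≤ Bd := by linarith
  have pt : ∀ a x : ℝ, 0 ≤ a → a ≤ 1 → (a - ρ) * x ≤ (1 - ρ) * max x 0 + ρ * max (-x) 0 ∧
      -(ρ * max x 0 + (1 - ρ) * max (-x) 0) ≤ (a - ρ) * x := by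
    intro a x ha0 ha1
    rcases le_total 0 x with hx | hx
    · rw [max_eq_left hx, max_eq_right (by linarith : -x ≤ 0)]
      constructor <;> nlinarith
    · rw [max_eq_right hx, max_eq_left (by linarith : 0 ≤ -x)]
      constructor <;> nlinarith
  have u : dd f ρ y Y Δ R n p ≤ (1 - ρ) * P + ρ * Q := by
    rw [hP, hQ, Finset.mul_sum, Finset.mul_sum, ← Finset.sum_add_distrib]
    exact Finset.sum_le_sum fun j _ => (pt _ _ (psi_nonneg _ _) (psi_le_one _ _)).1
  have l : -(ρ * P + (1 - ρ) * Q) ≤ dd f ρ y Y Δ R n p := by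
    rw [hP, hQ, Finset.mul_sum, Finset.mul_sum, ← Finset.sum_add_distrib, ← Finset.sum_neg_distrib]
    exact Finset.sum_le_sum fun j _ => (pt _ _ (psi_nonneg _ _) (psi_le_one _ _)).2
  rw [abs_le]
  constructor <;> nlinarith

theorem dd_lip (ρ y : ℝ) (hρ0 : 0 ≤ ρ) (hρ1 : ρ ≤ 1) {F : ℝ} (hF : ∀ x, |f x| ≤ F)
    (Y Δ R n n' : ℕ) (hn : n' ≤ n) (p : ℝ × ℝ) :
    |dd f ρ y Y Δ R n p - dd f ρ y Y Δ R n' p| ≤ F * ((n:ℝ) - n') := by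
  unfold dd
  rw [← Finset.sum_Ico_eq_sub _ hn]
  refine (Finset.abs_sum_le_sum_abs _ _).trans ?_
  have : ∀ j ∈ Finset.Ico n' n, |(psi f (j * p.1 + p.2) - ρ) * f (((Y:ℝ) + R * Δ) * y + j * y)| ≤ F := by
    intro j _
    rw [abs_mul]
    have h1 : |psi f (j * p.1 + p.2) - ρ| ≤ 1 := by
      rw [abs_le]
      constructor <;> linarith [psi_nonneg f (j * p.1 + p.2), psi_le_one f (j * p.1 + p.2)]
    calc _ ≤ 1 * F := mul_le_mul h1 (hF _) (abs_nonneg _) zero_le_one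
      _ = F := one_mul _
  refine (Finset.sum_le_sum this).trans ?_
  simp only [Finset.sum_const, Nat.card_Ico, nsmul_eq_mul]
  rw [Nat.cast_sub hn, mul_comm]

theorem checkpoint (Δ I n : ℕ) (hΔ : 0 < Δ) (hI : 0 < I) (hn : n ≤ Δ) :
    ∃ i ≤ I, min (i * Δ / I) Δ ≤ n ∧ (n:ℝ) - (min (i * Δ / I) Δ : ℕ) ≤ Δ / I + 1 := by
  refine ⟨n * I / Δ, ?_, ?_, ?_⟩
  · apply Nat.div_le_of_le_mul; nlinarith
  · refine (min_le_left _ _).trans ?_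
    apply Nat.div_le_of_le_mul
    rw [mul_comm I n]
    exact Nat.div_mul_le_self _ _
  · have h1 : n * I / Δ * Δ / I ≤ Δ := by
      apply Nat.div_le_of_le_mul
      have := Nat.div_mul_le_self (n * I) Δ
      nlinarith
    rw [min_eq_left h1]
    set i := n * I / Δ
    set k := i * Δ / I
    have a1 : n * I < (i + 1) * Δ := by
      have := Nat.lt_mul_div_succ (n * I) hΔ
      rw [mul_comm (i+1)]; exact this
    have a2 : i * Δ < (k + 1) * I := by
      have := Nat.lt_mul_div_succ (i * Δ) hI
      rw [mul_comm (k+1)]; exact this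
    have b1 : (n:ℝ) * I < (i + 1) * Δ := by exact_mod_cast a1
    have b2 : (i:ℝ) * Δ < (k + 1) * I := by exact_mod_cast a2
    have hI' : (0:ℝ) < I := by exact_mod_cast hI
    have : ((n:ℝ) - k) * I ≤ Δ + I := by nlinarith
    have e : (Δ:ℝ) / I + 1 = (Δ + I) / I := by field_simp
    rw [e, le_div_iff₀ hI']; exact this

/-- the grid of partial sums -/
noncomputable def XX (f : ℝ → ℝ) (ρ y : ℝ) (Y Δ I : ℕ) (r i : ℕ) (q : ℕ → ℝ × ℝ) : ℝ :=
  dd f ρ y Y Δ r (min (i * Δ / I) Δ) (q r)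

theorem XX_top (ρ y : ℝ) (Y Δ I : ℕ) (hI : 0 < I) (r : ℕ) (q : ℕ → ℝ × ℝ) :
    XX f ρ y Y Δ I r I q = dd f ρ y Y Δ r Δ (q r) := by
  unfold XX
  rw [Nat.mul_div_cancel_left _ hI, min_self]

theorem XX_zero (ρ y : ℝ) (Y Δ I : ℕ) (r : ℕ) (q : ℕ → ℝ × ℝ) :
    XX f ρ y Y Δ I r 0 q = 0 := by
  simp [XX, dd]

/-- bundle of the conclusions of `good_struct`. -/
def Good (X : ℕ → ℕ → ℝ) (I N : ℕ) (b : ℝ) : Prop :=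
  ∃ σ ≤ N, (∀ R < σ, ∀ i ≤ I, |∑ r ∈ Finset.Ico 0 R, X r I + X R i| ≤ b) ∧
    (∀ R < N, σ < R → ∀ i ≤ I, |∑ r ∈ Finset.Ico (σ + 1) R, X r I + X R i| ≤ b)

theorem A_sig {X : ℕ → ℕ → ℝ} {I : ℕ} {b : ℝ} (hb : 0 ≤ b) {σ : ℕ}
    (h : ∀ R < σ, ∀ i ≤ I, |∑ r ∈ Finset.Ico 0 R, X r I + X R i| ≤ b) :
    |∑ r ∈ Finset.range σ, X r I| ≤ b := by
  rcases σ with _ | s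
  · simpa using hb
  · rw [Finset.sum_range_succ, ← Nat.Ico_zero_eq_range]; exact h s (by omega) I le_rfl

theorem stage_upper (h : BVP f v V) (h0 : ∫ x in (0:ℝ)..1, f x = 0) {y C : ℝ} (hC : EqD y C)
    {ρ : ℝ} (hρ0 : 0 ≤ ρ) (hρ1 : ρ ≤ 1) {F : ℝ} (hF : ∀ x, |f x| ≤ F)
    (Y Δ N I : ℕ) (hΔ : 0 < Δ) (hI : 0 < I) (q : ℕ → ℝ × ℝ) {b : ℝ} (hb : 0 ≤ b)
    (hg : Good (fun r i => XX f ρ y Y Δ I r i q) I N b) (t : ℕ) (ht : t ≤ N * Δ) :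
    |St f y Y Δ q t| ≤ (∫ x in (0:ℝ)..1, max (f x) 0) * Δ + 2 * b + F * (Δ / I + 1)
      + C * V * (Δ:ℝ) ^ (1/4:ℝ) + C * V * ((N * Δ : ℕ):ℝ) ^ (1/4:ℝ) := by
  obtain ⟨σ, hσ, g1, g2⟩ := hg
  simp only [XX_top ρ y Y Δ I hI] at g1 g2
  have hH0 : 0 ≤ ∫ x in (0:ℝ)..1, max (f x) 0 :=
    intervalIntegral.integral_nonneg zero_le_one fun x _ => le_max_right _ _
  have hCV : 0 ≤ C * V := mul_nonneg hC.1 h.V_nonneg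
  have hF0 : 0 ≤ F := (abs_nonneg _).trans (hF 0)
  rcases Nat.eq_zero_or_pos t with rfl | htp
  · simp only [St, range_zero, Finset.sum_empty, abs_zero]; positivity
  obtain ⟨R, n, hR, hn, rfl⟩ : ∃ R n, R < N ∧ n ≤ Δ ∧ t = R * Δ + n := by
    refine ⟨(t-1)/Δ, (t-1) % Δ + 1, ?_, Nat.mod_lt _ hΔ, ?_⟩
    · rw [Nat.div_lt_iff_lt_mul hΔ]; omega
    · have := Nat.div_add_mod' (t-1) Δ; omega
  rw [St_decomp f ρ y Y Δ hΔ q R n hn]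
  have t1 : |ρ * ∑ j ∈ range (R * Δ + n), f (Y * y + j * y)| ≤ C * V * ((N * Δ : ℕ):ℝ) ^ (1/4:ℝ) := by
    have := hC.2 f v V h (Y * y) (R * Δ + n)
    rw [h0, mul_zero, sub_zero] at this
    have m : (((R * Δ + n : ℕ)):ℝ) ^ (1/4:ℝ) ≤ ((N * Δ : ℕ):ℝ) ^ (1/4:ℝ) :=
      rp_mono (by positivity) (by exact_mod_cast ht)
    rw [abs_mul, abs_of_nonneg hρ0]
    calc _ ≤ 1 * (C * V * (((R * Δ + n : ℕ)):ℝ) ^ (1/4:ℝ)) :=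
          mul_le_mul hρ1 this (abs_nonneg _) zero_le_one
      _ ≤ _ := by rw [one_mul]; exact mul_le_mul_of_nonneg_left m hCV
  set d := fun R n => dd f ρ y Y Δ R n (q R) with hd
  have hdb : ∀ R n, n ≤ Δ → |d R n| ≤ _ := fun R n hn => dd_bound h h0 hC hρ0 hρ1 Y Δ R n hn (q R)
  obtain ⟨i, hi, hc1, hc2⟩ := checkpoint Δ I n hΔ hI hn
  have hdc : |d R n - d R (min (i * Δ / I) Δ)| ≤ F * (Δ / I + 1) :=
    (dd_lip ρ y hρ0 hρ1 hF Y Δ R n _ hc1 (q R)).trans (mul_le_mul_of_nonneg_left hc2 hF0)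
  have As : |∑ r ∈ range σ, d r Δ| ≤ b := by
    have := A_sig (X := fun r i => XX f ρ y Y Δ I r i q) (I := I) hb (σ := σ)
      (by simpa only [XX_top ρ y Y Δ I hI] using g1)
    simpa only [XX_top ρ y Y Δ I hI] using this
  have main : |∑ r ∈ range R, d r Δ + d R n| ≤ (∫ x in (0:ℝ)..1, max (f x) 0) * Δ + 2 * b + F * (Δ / I + 1)
      + C * V * (Δ:ℝ) ^ (1/4:ℝ) := by
    have p1 : 0 ≤ (∫ x in (0:ℝ)..1, max (f x) 0) * Δ := by positivity
    have p2 : 0 ≤ C * V * (Δ:ℝ) ^ (1/4:ℝ) := by positivity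
    have p3 : 0 ≤ F * ((Δ:ℝ) / I + 1) := by positivity
    rcases lt_trichotomy R σ with hlt | heq | hgt
    · have := g1 R hlt i hi
      rw [Nat.Ico_zero_eq_range] at this
      have e : ∑ r ∈ range R, d r Δ + d R n = (∑ r ∈ range R, d r Δ + d R (min (i * Δ / I) Δ)) +
        (d R n - d R (min (i * Δ / I) Δ)) := by ring
      rw [e]
      refine (abs_add_le _ _).trans ?_
      have : |∑ r ∈ range R, d r Δ + d R (min (i * Δ / I) Δ)| ≤ b := this
      linarith
    · subst heq
      refine (abs_add_le _ _).trans ?_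
      linarith [hdb R n hn]
    · have := g2 R hR hgt i hi
      have : |∑ r ∈ Finset.Ico (σ+1) R, d r Δ + d R (min (i * Δ / I) Δ)| ≤ b := this
      have e : ∑ r ∈ range R, d r Δ + d R n = ∑ r ∈ range σ, d r Δ + d σ Δ +
        (∑ r ∈ Finset.Ico (σ+1) R, d r Δ + d R (min (i * Δ / I) Δ)) +
        (d R n - d R (min (i * Δ / I) Δ)) := by
        rw [← Finset.sum_range_add_sum_Ico _ (show σ + 1 ≤ R by omega), Finset.sum_range_succ]
        ring
      rw [e]
      refine (abs_add_le _ _).trans ?_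
      have a1 := abs_add_le (∑ r ∈ range σ, d r Δ + d σ Δ)
        (∑ r ∈ Finset.Ico (σ+1) R, d r Δ + d R (min (i * Δ / I) Δ))
      have a2 := abs_add_le (∑ r ∈ range σ, d r Δ) (d σ Δ)
      linarith [hdb σ Δ le_rfl]
  exact (abs_add_le _ _).trans (by linarith)

theorem stage_lower (h : BVP f v V) (h0 : ∫ x in (0:ℝ)..1, f x = 0) {y C : ℝ} (hC : EqD y C)
    {ρ : ℝ} (hρ0 : 0 ≤ ρ) (hρ1 : ρ ≤ 1)
    (Y Δ N I : ℕ) (hΔ : 0 < Δ) (hI : 0 < I) (q : ℕ → ℝ × ℝ) {b : ℝ} (hb : 0 ≤ b)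
    (hg : Good (fun r i => XX f ρ y Y Δ I r i q) I N b) (r : ℕ) (hr : r < N)
    (hp : 2 * b < dd f ρ y Y Δ r Δ (q r)) :
    ∃ t ≤ N * Δ, dd f ρ y Y Δ r Δ (q r) - b - C * V * ((N * Δ : ℕ):ℝ) ^ (1/4:ℝ) ≤ St f y Y Δ q t := by
  obtain ⟨σ, hσ, g1, g2⟩ := hg
  have As := A_sig (X := fun r i => XX f ρ y Y Δ I r i q) (I := I) hb (σ := σ) g1
  have ht : r * Δ + Δ ≤ N * Δ := by nlinarith
  have hCV : 0 ≤ C * V := mul_nonneg hC.1 h.V_nonneg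
  refine ⟨r * Δ + Δ, ht, ?_⟩
  rw [St_decomp f ρ y Y Δ hΔ q r Δ le_rfl]
  have t1 : |ρ * ∑ j ∈ range (r * Δ + Δ), f (Y * y + j * y)| ≤ C * V * ((N * Δ : ℕ):ℝ) ^ (1/4:ℝ) := by
    have := hC.2 f v V h (Y * y) (r * Δ + Δ)
    rw [h0, mul_zero, sub_zero] at this
    have m : (((r * Δ + Δ : ℕ)):ℝ) ^ (1/4:ℝ) ≤ ((N * Δ : ℕ):ℝ) ^ (1/4:ℝ) :=
      rp_mono (by positivity) (by exact_mod_cast ht)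
    rw [abs_mul, abs_of_nonneg hρ0]
    calc _ ≤ 1 * (C * V * (((r * Δ + Δ : ℕ)):ℝ) ^ (1/4:ℝ)) :=
          mul_le_mul hρ1 this (abs_nonneg _) zero_le_one
      _ ≤ _ := by rw [one_mul]; exact mul_le_mul_of_nonneg_left m hCV
  have hrσ : r = σ := by
    rcases lt_trichotomy r σ with hlt | heq | hgt
    · exfalso
      have a := g1 r hlt I le_rfl
      have b := g1 r hlt 0 (by omega)
      simp only [XX_zero, add_zero, XX_top ρ y Y Δ I hI] at a b
      rw [abs_le] at a b
      linarith [a.2, b.1]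
    · exact heq
    · exfalso
      have a := g2 r hr hgt I le_rfl
      have b := g2 r hr hgt 0 (by omega)
      simp only [XX_zero, add_zero, XX_top ρ y Y Δ I hI] at a b
      rw [abs_le] at a b
      linarith [a.2, b.1]
  subst hrσ
  simp only [XX_top ρ y Y Δ I hI] at As
  rw [abs_le] at As t1
  linarith [As.1, t1.1]

theorem peak_lower (h : BVP f v V) (h0 : ∫ x in (0:ℝ)..1, f x = 0) {y C : ℝ} (hC : EqD y C)
    {ρ : ℝ} (hρ0 : 0 ≤ ρ) (hρ1 : ρ ≤ 1) (Y Δ r : ℕ) (hΔ : 0 < Δ) (p : ℝ × ℝ) {η : ℝ}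
    (hz : Int.fract (p.1 - y) < η / Δ) (hθ : Int.fract (p.2 - ((Y:ℝ) + r * Δ) * y) < η) :
    (∫ x in (0:ℝ)..1, max (f x) 0) * Δ - 2 * η * V * Δ - 4 * (C * V * (Δ:ℝ) ^ (1/4:ℝ))
      ≤ dd f ρ y Y Δ r Δ p := by
  set φ := ((Y:ℝ) + r * Δ) * y with hφ
  have hΔ' : (0:ℝ) < Δ := by exact_mod_cast hΔ
  have h1 := (abs_le.1 (hC.2 _ v V h.pos_part φ Δ)).1
  have h2 := (abs_le.1 (hC.2 _ _ _ (h.modulus (2 * η)) φ Δ)).2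
  have h3 := (abs_le.1 (hC.2 _ v V h φ Δ)).2
  rw [h.modulus_int] at h2
  rw [h0] at h3
  set H := ∫ x in (0:ℝ)..1, max (f x) 0
  have hCV : 0 ≤ C * V * (Δ:ℝ) ^ (1/4:ℝ) :=
    mul_nonneg (mul_nonneg hC.1 h.V_nonneg) (by positivity)
  have pt : ∀ j ∈ range Δ, max (f (φ + j * y)) 0 - (v (φ + j * y + 2 * η) - v (φ + j * y)) ≤
      psi f (j * p.1 + p.2) * f (φ + j * y) := by
    intro j hj
    have hj' : (j:ℝ) ≤ Δ := by exact_mod_cast (Finset.mem_range.1 hj).le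
    set x := φ + j * y with hx
    set s := j * Int.fract (p.1 - y) + Int.fract (p.2 - φ) with hs
    have hs0 : 0 ≤ s := by
      have := Int.fract_nonneg (p.1 - y)
      have := Int.fract_nonneg (p.2 - φ)
      positivity
    have hs1 : s ≤ 2 * η := by
      have : j * Int.fract (p.1 - y) ≤ Δ * (η / Δ) :=
        mul_le_mul hj' hz.le (Int.fract_nonneg _) hΔ'.le
      rw [mul_div_cancel₀ _ hΔ'.ne'] at this
      linarith
    have e : f (j * p.1 + p.2) = f (x + s) := by
      rw [← per_int h.gper (j * ⌊p.1 - y⌋ + ⌊p.2 - φ⌋) (x + s)]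
      congr 1
      push_cast
      have e1 := Int.floor_add_fract (p.1 - y)
      have e2 := Int.floor_add_fract (p.2 - φ)
      rw [hx, hs]
      linear_combination -(j:ℝ) * e1 - e2
    have hb := h.bd x (x + s) (by linarith)
    have hmon := h.mono (show x + s ≤ x + 2 * η by linarith)
    have hw : |f (x + s) - f x| ≤ v (x + 2 * η) - v x := by linarith
    rw [abs_le] at hw
    unfold psi
    rw [e]
    split_ifs with hpos
    · rcases le_total 0 (f x) with hx0 | hx0
      · rw [max_eq_left hx0]; linarith
      · rw [max_eq_right hx0]; linarith
    · push Not at hpos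
      rcases le_total 0 (f x) with hx0 | hx0
      · rw [max_eq_left hx0]; linarith
      · rw [max_eq_right hx0]; linarith
  have h4 := Finset.sum_le_sum pt
  rw [Finset.sum_sub_distrib] at h4
  have e : dd f ρ y Y Δ r Δ p = ∑ j ∈ range Δ, psi f (j * p.1 + p.2) * f (φ + j * y) -
      ρ * ∑ j ∈ range Δ, f (φ + j * y) := by
    unfold dd
    rw [Finset.mul_sum, ← Finset.sum_sub_distrib]
    exact Finset.sum_congr rfl fun j _ => by ring
  rw [e]
  have h5 : ρ * ∑ j ∈ range Δ, f (φ + j * y) ≤ C * V * (Δ:ℝ) ^ (1/4:ℝ) := by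
    have : ∑ j ∈ range Δ, f (φ + j * y) ≤ C * V * (Δ:ℝ) ^ (1/4:ℝ) := by linarith
    nlinarith
  nlinarith
end Det

end Part5

section Part6
open MeasureTheory Filter Finset Real ProbabilityTheory

/-- the probability space -/
noncomputable def PP : Measure (ℕ → ℝ × ℝ) := Measure.infinitePi (fun _ : ℕ => blk)

instance : IsProbabilityMeasure PP := by unfold PP; infer_instance

theorem PP_ind : iIndepFun (fun (k : ℕ) (ω : ℕ → ℝ × ℝ) => ω k) PP :=
  iIndepFun_infinitePi (P := fun _ : ℕ => blk) (X := fun _ p => p) (fun _ => measurable_id)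

theorem PP_mp (k : ℕ) : MeasurePreserving (fun ω : ℕ → ℝ × ℝ => ω k) PP blk :=
  measurePreserving_eval_infinitePi (fun _ : ℕ => blk) k

theorem pair_inj (m : ℕ) : Function.Injective (Nat.pair m) := fun _ _ h => (Nat.pair_eq_pair.1 h).2

theorem PP_blk (m : ℕ) : Blk PP
    (fun r => MeasurableSpace.comap (fun ω : ℕ → ℝ × ℝ => ω (Nat.pair m r)) inferInstance) := by
  refine ⟨fun r => (measurable_pi_apply _).comap_le, ?_⟩
  exact (iIndepFun_iff_iIndep _ _ _).1 (PP_ind.precomp (pair_inj m))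

theorem PP_integral (k : ℕ) {G : ℝ × ℝ → ℝ} (hG : Measurable G) :
    ∫ ω, G (ω k) ∂PP = ∫ p, G p ∂blk := by
  rw [← (PP_mp k).map_eq, integral_map (measurable_pi_apply k).aemeasurable hG.aestronglyMeasurable]

theorem psi_meas {f : ℝ → ℝ} (hf : Measurable f) : Measurable (psi f) := by
  unfold psi
  exact Measurable.ite (measurableSet_lt measurable_const hf) measurable_const measurable_const

/-- density -/
noncomputable def rho (f : ℝ → ℝ) : ℝ := ∫ x, psi f x ∂uni

theorem rho_nonneg (f : ℝ → ℝ) : 0 ≤ rho f := integral_nonneg fun x => psi_nonneg f x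

theorem psi_integrable {f : ℝ → ℝ} (hf : Measurable f) : Integrable (psi f) uni :=
  Integrable.of_bound (psi_meas hf).aestronglyMeasurable 1 (Eventually.of_forall fun x => by
    rw [Real.norm_eq_abs, abs_of_nonneg (psi_nonneg f x)]; exact psi_le_one f x)

theorem rho_le_one {f : ℝ → ℝ} (hf : Measurable f) : rho f ≤ 1 := by
  calc rho f ≤ ∫ x, (1:ℝ) ∂uni :=
        integral_mono (psi_integrable hf) (integrable_const _) fun x => psi_le_one f x
    _ = 1 := by simp

theorem dd_meas {f : ℝ → ℝ} (hf : Measurable f) (ρ y : ℝ) (Y Δ R n : ℕ) :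
    Measurable (dd f ρ y Y Δ R n) := by
  unfold dd
  have := psi_meas hf
  fun_prop

section Stage
variable {f v : ℝ → ℝ} {V : ℝ}

theorem PP_adp (h : BVP f v V) {F : ℝ} (hF : ∀ x, |f x| ≤ F) (y : ℝ) (Y Δ I m i : ℕ) :
    Adp PP (fun r => MeasurableSpace.comap (fun ω : ℕ → ℝ × ℝ => ω (Nat.pair m r)) inferInstance)
      (fun r ω => XX f (rho f) y Y Δ I r i (fun r => ω (Nat.pair m r))) (F ^ 2 * Δ) := by
  have hfm := h.meas
  have gper : ∀ x, (fun x => psi f x - rho f) (x + 1) = (fun x => psi f x - rho f) x := by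
    intro x; simp only [psi, h.gper]
  have gm : Measurable (fun x => psi f x - rho f) := (psi_meas hfm).sub_const _
  have gK : ∀ x, |(fun x => psi f x - rho f) x| ≤ 1 := by
    intro x
    show |psi f x - rho f| ≤ 1
    rw [abs_le]
    constructor <;> linarith [psi_nonneg f x, psi_le_one f x, rho_nonneg f, rho_le_one hfm]
  have g0 : ∫ x, (fun x => psi f x - rho f) x ∂uni = 0 := by
    show ∫ x, (psi f x - rho f) ∂uni = 0
    rw [integral_sub (psi_integrable hfm) (integrable_const _)]
    simp [rho]
  have hF0 : 0 ≤ F := (abs_nonneg _).trans (hF 0)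
  refine ⟨fun r => ?_, fun r => ?_, fun r => ?_, fun r => ?_⟩
  · intro s hs
    exact ⟨_, dd_meas hfm (rho f) y Y Δ r (min (i * Δ / I) Δ) hs, rfl⟩
  · refine ⟨F * (((min (i * Δ / I) Δ : ℕ) : ℝ) - (0:ℕ)), fun ω => ?_⟩
    have := dd_lip (f := f) (rho f) y (rho_nonneg f) (rho_le_one hfm) hF Y Δ r (min (i * Δ / I) Δ) 0
      (Nat.zero_le _) (ω (Nat.pair m r))
    simpa [dd, XX] using this
  · have := blk_sum_mean gper gm gK g0 (fun j => f (((Y:ℝ) + r * Δ) * y + j * y)) (min (i * Δ / I) Δ)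
    show ∫ ω, dd f (rho f) y Y Δ r (min (i * Δ / I) Δ) (ω (Nat.pair m r)) ∂PP = 0
    rw [PP_integral _ (dd_meas hfm _ _ _ _ _ _)]
    exact this
  · have := blk_sum_sq gper gm gK g0 (fun j => f (((Y:ℝ) + r * Δ) * y + j * y)) (min (i * Δ / I) Δ)
      (fun j => hF _)
    show ∫ ω, (fun p => (dd f (rho f) y Y Δ r (min (i * Δ / I) Δ) p) ^ 2) (ω (Nat.pair m r)) ∂PP ≤ _
    rw [PP_integral _ ((dd_meas hfm _ _ _ _ _ _).pow_const 2)]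
    refine le_trans this ?_
    rw [mul_comm]
    have : ((min (i * Δ / I) Δ : ℕ) : ℝ) ≤ Δ := by exact_mod_cast min_le_right _ _
    gcongr

theorem good_ae (h : BVP f v V) {F : ℝ} (hF : ∀ x, |f x| ≤ F) (y : ℝ) (Y Δ N : ℕ → ℕ)
    (hΔ : ∀ m, 0 < Δ m) (hsum : Summable fun m => ((N m : ℝ) / Δ m) ^ 2) (I : ℕ) {ε : ℝ}
    (hε : 0 < ε) :
    ∀ᵐ ω ∂PP, ∀ᶠ m in atTop, Good (fun r i => XX f (rho f) y (Y m) (Δ m) I r i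
      (fun r => ω (Nat.pair m r))) I (N m) (4 * (ε * Δ m)) := by
  have hb : ∀ m, PP (notGood (fun r i ω => XX f (rho f) y (Y m) (Δ m) I r i
      (fun r => ω (Nat.pair m r))) I (N m) (4 * (ε * Δ m))) ≤
      ENNReal.ofReal (((I + 3) * (F ^ 2 / ε ^ 2)) ^ 2 * ((N m : ℝ) / Δ m) ^ 2) := by
    intro m
    have hd : (0:ℝ) < Δ m := by exact_mod_cast hΔ m
    refine (notGood_prob (PP_blk m) (fun i => PP_adp h hF y (Y m) (Δ m) I m i) (N m)
      (a := ε * Δ m) (by positivity) (by positivity)).trans (le_of_eq ?_)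
    congr 1
    field_simp
  have hfin : ∑' m, PP (notGood (fun r i ω => XX f (rho f) y (Y m) (Δ m) I r i
      (fun r => ω (Nat.pair m r))) I (N m) (4 * (ε * Δ m))) ≠ ⊤ := by
    refine ne_top_of_le_ne_top ?_ (ENNReal.tsum_le_tsum hb)
    exact (hsum.mul_left _).tsum_ofReal_ne_top
  filter_upwards [ae_eventually_notMem hfin] with ω hω
  filter_upwards [hω] with m hm
  exact good_struct (X := fun r i (ω : ℕ → ℝ × ℝ) => XX f (rho f) y (Y m) (Δ m) I r i
      (fun r => ω (Nat.pair m r))) hm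

theorem peak_ae (y : ℝ) (Y Δ N : ℕ → ℕ)
    (hΔ : ∀ m, 0 < Δ m) (hsum : ¬ Summable fun m => ((N m : ℝ) / Δ m)) {η : ℝ}
    (hη : 0 < η) (hη1 : η ≤ 1) :
    ∀ᵐ ω ∂PP, ∃ᶠ m in atTop, ∃ r < N m, Int.fract ((ω (Nat.pair m r)).1 - y) < η / Δ m ∧
      Int.fract ((ω (Nat.pair m r)).2 - ((Y m:ℝ) + r * Δ m) * y) < η := by
  let B : ℕ → Set (ℝ × ℝ) := fun k => {p | k.unpair.2 < N k.unpair.1 ∧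
    (Int.fract (p.1 - y) < η / Δ k.unpair.1 ∧
      Int.fract (p.2 - ((Y k.unpair.1:ℝ) + k.unpair.2 * Δ k.unpair.1) * y) < η)}
  have hBm : ∀ k, MeasurableSet (B k) := by
    intro k
    refine MeasurableSet.inter (MeasurableSet.const _) (MeasurableSet.inter ?_ ?_)
    · have : Measurable fun p : ℝ × ℝ => Int.fract (p.1 - y) := by fun_prop
      exact measurableSet_lt this measurable_const
    · have : Measurable fun p : ℝ × ℝ =>
          Int.fract (p.2 - ((Y k.unpair.1:ℝ) + k.unpair.2 * Δ k.unpair.1) * y) := by fun_prop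
      exact measurableSet_lt this measurable_const
  let E : ℕ → Set (ℕ → ℝ × ℝ) := fun k => (fun ω => ω k) ⁻¹' B k
  have hEm : ∀ k, MeasurableSet (E k) := fun k => (measurable_pi_apply k) (hBm k)
  have hEi : iIndepSet E PP := by
    rw [iIndepSet_iff_meas_biInter hEm]
    intro s
    have := (iIndepFun_iff_measure_inter_preimage_eq_mul.1 PP_ind) s (sets := B) (fun i _ => hBm i)
    exact this
  have hEs : ∑' k, PP (E k) = ⊤ := by
    have e : ∀ k, PP (E k) = blk (B k) := fun k => (PP_mp k).measure_preimage (hBm k).nullMeasurableSet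
    simp only [e]
    rw [← Nat.pairEquiv.tsum_eq, ENNReal.tsum_prod']
    have lb : ∀ m, ENNReal.ofReal (η ^ 2 * ((N m : ℝ) / Δ m)) ≤
        ∑' r, blk (B (Nat.pairEquiv (m, r))) := by
      intro m
      have hd : (1:ℝ) ≤ Δ m := by exact_mod_cast hΔ m
      refine le_trans ?_ (ENNReal.sum_le_tsum (Finset.range (N m)))
      have : ∀ r ∈ Finset.range (N m), ENNReal.ofReal (η / Δ m * η) ≤ blk (B (Nat.pairEquiv (m, r))) := by
        intro r hr
        have e : B (Nat.pairEquiv (m, r)) = {p | Int.fract (p.1 - y) < η / Δ m ∧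
            Int.fract (p.2 - ((Y m:ℝ) + r * Δ m) * y) < η} := by
          ext p
          simp [B, Finset.mem_range.1 hr]
        rw [e, ENNReal.ofReal_mul (by positivity)]
        exact blk_peak _ _ ((div_le_self hη.le hd).trans hη1) hη1
      refine le_trans (le_of_eq ?_) (Finset.sum_le_sum this)
      rw [Finset.sum_const, Finset.card_range, nsmul_eq_mul, ← ENNReal.ofReal_natCast,
        ← ENNReal.ofReal_mul (by positivity)]
      congr 1
      ring
    refine top_le_iff.1 (le_trans (le_of_eq ?_) (ENNReal.tsum_le_tsum lb))
    by_contra hne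
    apply hsum
    have h1 := ENNReal.summable_toReal (Ne.symm hne)
    have h2 : ∀ m, (ENNReal.ofReal (η ^ 2 * ((N m : ℝ) / Δ m))).toReal = η ^ 2 * ((N m : ℝ) / Δ m) :=
      fun m => ENNReal.toReal_ofReal (by positivity)
    simp only [h2] at h1
    exact (summable_mul_left_iff (by positivity)).1 h1
  have h1 := measure_limsup_eq_one hEm hEi hEs
  have h2 : ∀ᵐ ω ∂PP, ω ∈ limsup E atTop := by
    have hm : MeasurableSet (limsup E atTop) := MeasurableSet.measurableSet_limsup hEm
    exact (prob_compl_eq_zero_iff hm).2 h1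
  filter_upwards [h2] with ω hω
  rw [mem_limsup_iff_frequently_mem] at hω
  rw [frequently_atTop] at hω ⊢
  intro m0
  obtain ⟨K, hK⟩ : ∃ K, ∀ m < m0, ∀ r < N m, Nat.pair m r < K := by
    have hfin : (⋃ m ∈ Set.Iio m0, (fun r => Nat.pair m r) '' Set.Iio (N m)).Finite :=
      (Set.finite_Iio m0).biUnion fun m _ => (Set.finite_Iio _).image _
    obtain ⟨K, hK⟩ := hfin.bddAbove
    refine ⟨K + 1, fun m hm r hr => Nat.lt_succ_of_le (hK ?_)⟩
    simp only [Set.mem_iUnion]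
    exact ⟨m, hm, r, hr, rfl⟩
  obtain ⟨k, hk, hkE⟩ := hω K
  have hkB : ω k ∈ B k := hkE
  obtain ⟨b1, b2, b3⟩ := hkB
  refine ⟨k.unpair.1, ?_, k.unpair.2, b1, ?_⟩
  · by_contra hlt
    push Not at hlt
    have := hK _ hlt _ b1
    rw [Nat.pair_unpair] at this
    omega
  · rw [Nat.pair_unpair]; exact ⟨b2, b3⟩
end Stage

end Part6

section Part7
open MeasureTheory Filter Finset Real ProbabilityTheory

/-- the conclusion for a given outcome -/
def Concl (f : ℝ → ℝ) (H : ℝ) (Y Δ N : ℕ → ℕ) (ω : ℕ → ℝ × ℝ) (y : ℝ) (δ : ℝ) : Prop :=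
  (∀ᶠ m in atTop, ∀ t ≤ N m * Δ m,
      |St f y (Y m) (Δ m) (fun r => ω (Nat.pair m r)) t| ≤ (H + δ) * Δ m) ∧
  (∃ᶠ m in atTop, ∃ t ≤ N m * Δ m,
      (H - δ) * Δ m ≤ St f y (Y m) (Δ m) (fun r => ω (Nat.pair m r)) t)

theorem Concl.mono {f : ℝ → ℝ} {H : ℝ} {Y Δ N : ℕ → ℕ} {ω : ℕ → ℝ × ℝ} {y δ δ' : ℝ}
    (h : Concl f H Y Δ N ω y δ) (hd : δ ≤ δ') : Concl f H Y Δ N ω y δ' := by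
  refine ⟨h.1.mono fun m hm t ht => (hm t ht).trans ?_, h.2.mono ?_⟩
  · gcongr
  · rintro m ⟨t, ht, h⟩
    exact ⟨t, ht, le_trans (by gcongr) h⟩

section Main
variable {f v : ℝ → ℝ} {V : ℝ}

theorem stage_y (h : BVP f v V) (h0 : ∫ x in (0:ℝ)..1, f x = 0) {H : ℝ}
    (hH : H = ∫ x in (0:ℝ)..1, max (f x) 0) (Y Δ N : ℕ → ℕ)
    (hΔ : ∀ m, 0 < Δ m) (hΔY : ∀ m, Δ m ≤ Y m) (hNY : ∀ m, N m * Δ m ≤ Y m)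
    (hY : Tendsto (fun m => (Y m : ℝ) ^ (1/4:ℝ) / Δ m) atTop (nhds 0))
    (hs2 : Summable fun m => ((N m : ℝ) / Δ m) ^ 2)
    (hs1 : ¬ Summable fun m => ((N m : ℝ) / Δ m))
    {y C : ℝ} (hC : EqD y C) {δ : ℝ} (hδ : 0 < δ) (hδH : δ ≤ H) :
    ∀ᵐ ω ∂PP, Concl f H Y Δ N ω y δ := by
  have hF := h.bounded
  set F := |f 0| + V with hFd
  have hV := h.V_nonneg
  have hF0 : 0 ≤ F := by positivity
  have hCV : 0 ≤ C * V := mul_nonneg hC.1 hV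
  obtain ⟨I, hI⟩ := exists_nat_gt (4 * F / δ)
  have hI0 : (0:ℝ) < I := lt_of_le_of_lt (by positivity) hI
  have hIp : 0 < I := by exact_mod_cast hI0
  have hFI : F / I ≤ δ / 4 := by
    rw [div_lt_iff₀ hδ] at hI
    rw [div_le_div_iff₀ hI0 (by norm_num)]; linarith
  set η := min 1 (δ / (8 * (V + 1))) with hη
  have hη0 : 0 < η := lt_min one_pos (by positivity)
  have hη1 : η ≤ 1 := min_le_left _ _
  have hηV : 2 * η * V ≤ δ / 4 := by
    have : η ≤ δ / (8 * (V + 1)) := min_le_right _ _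
    rw [le_div_iff₀ (by positivity)] at this
    nlinarith
  have hρ0 := rho_nonneg f
  have hρ1 := rho_le_one h.meas
  set K := F + 4 * (C * V) with hK
  have hev : ∀ᶠ m in atTop, K * (Y m : ℝ) ^ (1/4:ℝ) ≤ δ / 4 * Δ m := by
    have := hY.const_mul K
    rw [mul_zero] at this
    filter_upwards [this.eventually (ge_mem_nhds (show 0 < δ / 4 by positivity))] with m hm
    have hd : (0:ℝ) < Δ m := by exact_mod_cast hΔ m
    rwa [← mul_div_assoc, div_le_iff₀ hd] at hm
  have hone : ∀ m, 1 ≤ (Y m : ℝ) ^ (1/4:ℝ) := fun m =>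
    Real.one_le_rpow (by exact_mod_cast (hΔ m).trans_le (hΔY m)) (by norm_num)
  have hr1 : ∀ m, C * V * (Δ m : ℝ) ^ (1/4:ℝ) ≤ C * V * (Y m : ℝ) ^ (1/4:ℝ) := fun m =>
    mul_le_mul_of_nonneg_left (rp_mono (by positivity) (by exact_mod_cast hΔY m)) hCV
  have hr2 : ∀ m, C * V * ((N m * Δ m : ℕ) : ℝ) ^ (1/4:ℝ) ≤ C * V * (Y m : ℝ) ^ (1/4:ℝ) := fun m =>
    mul_le_mul_of_nonneg_left (rp_mono (by positivity) (by exact_mod_cast hNY m)) hCV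
  filter_upwards [good_ae h hF y Y Δ N hΔ hs2 I (show 0 < δ / 32 by positivity),
    peak_ae y Y Δ N hΔ hs1 hη0 hη1] with ω hω1 hω2
  refine ⟨?_, ?_⟩
  · filter_upwards [hω1, hev] with m hm hm2 t ht
    have hd : (0:ℝ) < Δ m := by exact_mod_cast hΔ m
    have := stage_upper h h0 hC hρ0 hρ1 hF (Y m) (Δ m) (N m) I (hΔ m) hIp _ (by positivity) hm t ht
    rw [← hH] at this
    have e : F * ((Δ m:ℝ) / I + 1) = F / I * Δ m + F := by ring
    rw [e] at this
    have a1 : F / I * Δ m ≤ δ / 4 * Δ m := by gcongr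
    have a2 : F ≤ F * (Y m : ℝ) ^ (1/4:ℝ) := le_mul_of_one_le_right hF0 (hone m)
    have a3 := hr1 m
    have a4 := hr2 m
    have a5 : 0 ≤ C * V * (Y m : ℝ) ^ (1/4:ℝ) := by positivity
    rw [hK] at hm2
    nlinarith
  · refine (hω2.and_eventually (hω1.and hev)).mono ?_
    rintro m ⟨⟨r, hr, p1, p2⟩, hm, hm2⟩
    have hd : (0:ℝ) < Δ m := by exact_mod_cast hΔ m
    have a1 := peak_lower h h0 hC hρ0 hρ1 (Y m) (Δ m) r (hΔ m) _ p1 p2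
    rw [← hH] at a1
    have a3 := hr1 m
    have a4 := hr2 m
    have a5 : 0 ≤ C * V * (Y m : ℝ) ^ (1/4:ℝ) := by positivity
    have a6 : 2 * η * V * Δ m ≤ δ / 4 * Δ m := by gcongr
    have a7 : 0 ≤ F * (Y m : ℝ) ^ (1/4:ℝ) := by positivity
    have a8 : δ * Δ m ≤ H * Δ m := by gcongr
    have a9 : 0 < δ * Δ m := by positivity
    rw [hK] at hm2
    have hm3 : F * (Y m : ℝ) ^ (1/4:ℝ) + 4 * (C * V * (Y m : ℝ) ^ (1/4:ℝ)) ≤ δ / 4 * Δ m := by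
      linarith
    obtain ⟨t, ht, hl⟩ := stage_lower h h0 hC hρ0 hρ1 (Y m) (Δ m) (N m) I (hΔ m) hIp
      (fun r => ω (Nat.pair m r)) (by positivity) hm r hr (by linarith)
    refine ⟨t, ht, le_trans ?_ hl⟩
    linarith

theorem St_meas (hf : Measurable f) (Y Δ m t : ℕ) :
    Measurable fun p : ℝ × (ℕ → ℝ × ℝ) => St f p.1 Y Δ (fun r => p.2 (Nat.pair m r)) t := by
  unfold St
  have := psi_meas hf
  refine Finset.measurable_sum _ fun j _ => Measurable.mul ?_ ?_
  · refine this.comp ?_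
    have h1 : Measurable fun p : ℝ × (ℕ → ℝ × ℝ) => p.2 (Nat.pair m (j / Δ)) :=
      (measurable_pi_apply _).comp measurable_snd
    exact ((measurable_fst.comp h1).const_mul _).add (measurable_snd.comp h1)
  · exact hf.comp (measurable_fst.const_mul _)

theorem Concl_meas (hf : Measurable f) (H : ℝ) (Y Δ N : ℕ → ℕ) (δ : ℝ) :
    MeasurableSet {p : ℝ × (ℕ → ℝ × ℝ) | Concl f H Y Δ N p.2 p.1 δ} := by
  unfold Concl
  simp only [eventually_atTop, frequently_atTop]
  refine MeasurableSet.inter ?_ ?_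
  · refine measurableSet_setOfPred.2 ?_
    refine Measurable.exists fun a => Measurable.forall fun m => Measurable.forall fun _ =>
      Measurable.forall fun t => Measurable.forall fun _ => measurableSet_setOfPred.1 ?_
    exact measurableSet_le (continuous_abs.measurable.comp (St_meas hf _ _ _ _)) measurable_const
  · refine measurableSet_setOfPred.2 ?_
    refine Measurable.forall fun a => Measurable.exists fun m => Measurable.and measurable_const <|
      Measurable.exists fun t => Measurable.and measurable_const <| measurableSet_setOfPred.1 ?_
    exact measurableSet_le measurable_const (St_meas hf _ _ _ _)

theorem stage_all (h : BVP f v V) (h0 : ∫ x in (0:ℝ)..1, f x = 0) {H : ℝ}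
    (hH : H = ∫ x in (0:ℝ)..1, max (f x) 0) (hH0 : 0 < H) (Y Δ N : ℕ → ℕ)
    (hΔ : ∀ m, 0 < Δ m) (hΔY : ∀ m, Δ m ≤ Y m) (hNY : ∀ m, N m * Δ m ≤ Y m)
    (hY : Tendsto (fun m => (Y m : ℝ) ^ (1/4:ℝ) / Δ m) atTop (nhds 0))
    (hs2 : Summable fun m => ((N m : ℝ) / Δ m) ^ 2)
    (hs1 : ¬ Summable fun m => ((N m : ℝ) / Δ m)) :
    ∃ ω, ∀ᵐ y : ℝ, ∀ δ > 0, Concl f H Y Δ N ω y δ := by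
  have h1 : ∀ᵐ ω ∂PP, ∀ᵐ y : ℝ, ∀ k : ℕ, Concl f H Y Δ N ω y (1 / ((k:ℝ) + 1)) := by
    have : MeasurableSet {p : ℝ × (ℕ → ℝ × ℝ) | ∀ k : ℕ, Concl f H Y Δ N p.2 p.1 (1 / ((k:ℝ) + 1))} := by
      refine measurableSet_setOfPred.2 (Measurable.forall fun k => measurableSet_setOfPred.1 ?_)
      exact Concl_meas h.meas H Y Δ N _
    refine (Measure.ae_ae_comm (μ := volume) (ν := PP)
      (p := fun (y : ℝ) ω => ∀ k : ℕ, Concl f H Y Δ N ω y (1 / ((k:ℝ) + 1))) this).1 ?_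
    filter_upwards [ae_eqD] with y hy
    obtain ⟨C, hC⟩ := hy
    rw [ae_all_iff]
    intro k
    have hk : (0:ℝ) < 1 / ((k:ℝ) + 1) := by positivity
    filter_upwards [stage_y h h0 hH Y Δ N hΔ hΔY hNY hY hs2 hs1 hC (lt_min hk hH0)
      (min_le_right _ _)] with ω hω
    exact hω.mono (min_le_left _ _)
  obtain ⟨ω, hω⟩ := h1.exists
  refine ⟨ω, hω.mono fun y hy δ hδ => ?_⟩
  obtain ⟨k, hk⟩ := exists_nat_one_div_lt hδ
  exact (hy k).mono hk.le
end Main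

end Part7

section Part8
open MeasureTheory Filter Finset Real ProbabilityTheory

/-- the scale at a point -/
noncomputable def sc (x : ℝ) : ℝ := Real.sqrt (2 * x * Real.log (Real.log x))

theorem loglog_atTop : Tendsto (fun x : ℝ => Real.log (Real.log x)) atTop atTop :=
  Real.tendsto_log_atTop.comp Real.tendsto_log_atTop

theorem sqrt_le_sc : ∀ᶠ x : ℝ in atTop, Real.sqrt x ≤ sc x := by
  filter_upwards [loglog_atTop.eventually_ge_atTop 1, eventually_ge_atTop 0] with x h1 h2
  unfold sc
  apply Real.sqrt_le_sqrt
  nlinarith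

theorem sc_b {κ ε : ℝ} (hκ : 0 < κ) (hε : 0 < ε) :
    ∀ᶠ x : ℝ in atTop, x ^ (1/4:ℝ) ≤ ε * (κ * sc x - 1) := by
  have hw := tendsto_rpow_atTop (show (0:ℝ) < 1/4 by norm_num)
  filter_upwards [sqrt_le_sc, hw.eventually_ge_atTop ((1 / ε + 1) / κ), hw.eventually_ge_atTop 1,
    eventually_ge_atTop 0] with x h1 h2 h3 h4
  have e : Real.sqrt x = (x ^ (1/4:ℝ)) ^ 2 := by
    rw [Real.sqrt_eq_rpow, ← Real.rpow_natCast, ← Real.rpow_mul h4]; norm_num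
  rw [e] at h1
  set w := x ^ (1/4:ℝ)
  rw [div_le_iff₀ hκ] at h2
  have h5 : (1 / ε + 1) * w ≤ κ * w ^ 2 := by nlinarith
  have h6 : κ * w ^ 2 ≤ κ * sc x := by gcongr
  have h7 : 1 / ε * w ≤ κ * sc x - 1 := by linarith
  calc w = ε * (1 / ε * w) := by field_simp
    _ ≤ _ := by gcongr

theorem sc_a {κ : ℝ} (hκ : 0 < κ) : ∀ᶠ x : ℝ in atTop, κ * sc x ≤ x := by
  have hlo := Real.isLittleO_log_id_atTop.def (show 0 < 1 / (2 * κ ^ 2) by positivity)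
  filter_upwards [hlo, eventually_ge_atTop 1] with x h1 h2
  have hl : 0 ≤ Real.log x := Real.log_nonneg h2
  have h3 : Real.log (Real.log x) ≤ Real.log x := Real.log_le_self hl
  simp only [id, Real.norm_eq_abs] at h1
  rw [abs_of_nonneg hl, abs_of_nonneg (by linarith)] at h1
  have h4 : κ ^ 2 * (2 * x * Real.log (Real.log x)) ≤ x ^ 2 := by
    have h5 : Real.log (Real.log x) ≤ 1 / (2 * κ ^ 2) * x := by linarith
    calc κ ^ 2 * (2 * x * Real.log (Real.log x)) ≤ κ ^ 2 * (2 * x * (1 / (2 * κ ^ 2) * x)) := by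
          gcongr
      _ = x ^ 2 := by field_simp
  have : κ * sc x = Real.sqrt (κ ^ 2 * (2 * x * Real.log (Real.log x))) := by
    rw [sc, Real.sqrt_mul (show 0 ≤ κ ^ 2 by positivity), Real.sqrt_sq hκ.le]
  rw [this]
  calc _ ≤ Real.sqrt (x ^ 2) := Real.sqrt_le_sqrt h4
    _ = x := Real.sqrt_sq (by linarith)

theorem sc_c {κ K : ℝ} (hκ : 0 < κ) (hK : 0 < K) :
    ∀ᶠ x : ℝ in atTop, K * (Real.log x) ^ 2 ≤ κ * sc x - 1 := by
  have h1 := (isLittleO_log_rpow_rpow_atTop 2 (show (0:ℝ) < 1/4 by norm_num)).def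
    (show 0 < 1 / K by positivity)
  filter_upwards [h1, sc_b hκ one_pos, eventually_ge_atTop 1] with x a b c
  have hl : 0 ≤ Real.log x := Real.log_nonneg c
  rw [Real.norm_eq_abs, Real.norm_eq_abs, abs_of_nonneg (by positivity),
    abs_of_nonneg (by positivity)] at a
  have e : Real.log x ^ (2:ℝ) = Real.log x ^ 2 := by norm_cast
  rw [e] at a
  calc K * Real.log x ^ 2 ≤ K * (1 / K * x ^ (1/4:ℝ)) := by gcongr
    _ = x ^ (1/4:ℝ) := by field_simp
    _ ≤ _ := by linarith

/-- stage positions -/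
def YY (m : ℕ) : ℕ := 2 ^ 3 ^ (m + 2)

theorem YY_succ (m : ℕ) : YY (m + 1) = YY m ^ 3 := by
  unfold YY; rw [← pow_mul]; congr 1

theorem YY_ge (m : ℕ) : 2 ^ (m + 2) ≤ YY m := by
  unfold YY
  exact Nat.pow_le_pow_right (by norm_num) (Nat.lt_pow_self (by norm_num)).le

theorem YY_two (m : ℕ) : 2 ≤ YY m := by
  refine le_trans ?_ (YY_ge m)
  calc 2 = 2 ^ 1 := rfl
    _ ≤ _ := Nat.pow_le_pow_right (by norm_num) (by omega)

theorem YY_tendsto : Tendsto (fun m => (YY m : ℝ)) atTop atTop := by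
  refine tendsto_natCast_atTop_atTop.comp (tendsto_atTop_mono (fun m => ?_) tendsto_id)
  have := YY_ge m
  have : m + 2 < 2 ^ (m + 2) := Nat.lt_pow_self (by norm_num)
  simp only [id]; omega

theorem YY_loglog (m : ℕ) : (m:ℝ) + 1 ≤ Real.log (Real.log (YY m)) ∧
    Real.log (Real.log (YY m)) ≤ 2 * ((m:ℝ) + 2) := by
  have l2 : 0 < Real.log 2 := Real.log_pos (by norm_num)
  have e : Real.log (Real.log (YY m)) = ((m:ℝ) + 2) * Real.log 3 + Real.log (Real.log 2) := by
    unfold YY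
    push_cast
    rw [Real.log_pow]
    push_cast
    rw [Real.log_mul (by positivity) l2.ne', Real.log_pow]
    push_cast; ring
  have h3 : 1.09 ≤ Real.log 3 := by
    have := Real.exp_one_lt_d9
    have h4 : Real.log 3 = Real.log (3 / Real.exp 1) + 1 := by
      rw [Real.log_div (by norm_num) (Real.exp_pos _).ne', Real.log_exp]; ring
    have h5 := Real.one_sub_inv_le_log_of_pos (show 0 < 3 / Real.exp 1 by positivity)
    rw [h4]
    rw [inv_div] at h5
    linarith
  have h3' : Real.log 3 ≤ 2 := by
    have := Real.log_le_sub_one_of_pos (show (0:ℝ) < 3 by norm_num); linarith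
  have hl1 : -0.45 ≤ Real.log (Real.log 2) := by
    have := Real.log_two_gt_d9
    have h5 := Real.one_sub_inv_le_log_of_pos l2
    have : (Real.log 2)⁻¹ ≤ 1.45 := by
      rw [inv_le_comm₀ l2 (by norm_num)]; norm_num at this ⊢; linarith
    linarith
  have hl2 : Real.log (Real.log 2) ≤ 0 := by
    apply Real.log_nonpos l2.le
    have := Real.log_two_lt_d9; linarith
  rw [e]
  have hm : (0:ℝ) ≤ m := Nat.cast_nonneg m
  constructor <;> nlinarith

/-- probabilities -/
noncomputable def pp (m : ℕ) : ℝ := 1 / (((m:ℝ) + 2) * Real.log ((m:ℝ) + 2))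

theorem lg_pos (m : ℕ) : 0 < Real.log ((m:ℝ) + 2) :=
  Real.log_pos (by have : (0:ℝ) ≤ m := Nat.cast_nonneg m
                   linarith)

theorem pp_pos (m : ℕ) : 0 < pp m := by
  have := lg_pos m
  unfold pp; positivity

theorem pp_ge (m : ℕ) : 1 / ((m:ℝ) + 2) ^ 2 ≤ pp m := by
  have h := lg_pos m
  unfold pp
  apply one_div_le_one_div_of_le (by positivity)
  rw [sq]
  gcongr
  exact Real.log_le_self (by positivity)

theorem pp_sq : Summable fun m => pp m ^ 2 := by
  have h1 : Summable fun m : ℕ => 1 / ((m:ℝ) + 2) ^ 2 := by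
    have := (summable_nat_add_iff 2).2 (Real.summable_one_div_nat_pow.2 (show 1 < 2 by norm_num))
    simpa using this
  have l2 : 0 < Real.log 2 := Real.log_pos (by norm_num)
  refine Summable.of_nonneg_of_le (fun m => by positivity) (fun m => ?_)
    (h1.mul_left (1 / Real.log 2 ^ 2))
  unfold pp
  rw [div_pow, one_pow, mul_pow, div_mul_div_comm, one_mul, mul_comm (Real.log 2 ^ 2)]
  apply one_div_le_one_div_of_le (by positivity)
  have : Real.log 2 ≤ Real.log ((m:ℝ) + 2) := Real.log_le_log (by norm_num) (by
    have : (0:ℝ) ≤ m := Nat.cast_nonneg m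
    linarith)
  gcongr

theorem pp_not : ¬ Summable pp := by
  intro h
  let g : ℕ → ℝ := fun n => 1 / ((n:ℝ) * Real.log n)
  have h2 : Summable g := by
    rw [← summable_nat_add_iff 2]
    refine h.congr fun n => ?_
    simp only [g, pp]; push_cast; rfl
  have hg0 : ∀ n, 0 ≤ g n := by
    intro n
    simp only [g]
    have : 0 ≤ Real.log (n:ℝ) := Real.log_natCast_nonneg n
    positivity
  have h3 := (summable_condensed_iff_of_eventually_nonneg (f := g) (Eventually.of_forall hg0) ?_).2 h2
  · have e : ∀ k : ℕ, (2:ℝ) ^ k * g (2 ^ k) = (1 / Real.log 2) * (1 / (k:ℝ)) := by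
      intro k
      simp only [g]
      push_cast
      rw [Real.log_pow]
      have : (2:ℝ) ^ k ≠ 0 := by positivity
      field_simp
    simp only [e] at h3
    have l2 : 0 < Real.log 2 := Real.log_pos (by norm_num)
    rw [summable_mul_left_iff (by positivity)] at h3
    exact Real.not_summable_one_div_natCast h3
  · filter_upwards [eventually_ge_atTop 2] with k hk
    have hk' : (2:ℝ) ≤ k := by exact_mod_cast hk
    have l : 0 < Real.log (k:ℝ) := Real.log_pos (by linarith)
    simp only [g]
    push_cast
    apply one_div_le_one_div_of_le (by positivity)
    have : Real.log (k:ℝ) ≤ Real.log ((k:ℝ) + 1) := Real.log_le_log (by linarith) (by linarith)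
    gcongr
    linarith

theorem exists_params {κ : ℝ} (hκ : 0 < κ) : ∃ Δ N : ℕ → ℕ,
    (∀ m, 0 < Δ m) ∧ (∀ m, Δ m ≤ YY m) ∧ (∀ m, N m * Δ m ≤ YY m) ∧
    Tendsto (fun m => (YY m : ℝ) ^ (1/4:ℝ) / Δ m) atTop (nhds 0) ∧
    (Summable fun m => ((N m : ℝ) / Δ m) ^ 2) ∧ (¬ Summable fun m => ((N m : ℝ) / Δ m)) ∧
    (∀ᶠ m in atTop, (Δ m : ℝ) ≤ κ * sc (YY m) ∧ κ * sc (YY m) - 1 ≤ Δ m) ∧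
    (∀ ε > 0, ∀ᶠ m in atTop, ((N m * Δ m : ℕ):ℝ) ≤ ε * YY m) := by
  let Δ : ℕ → ℕ := fun m => max 1 (min (YY m) ⌊κ * sc (YY m)⌋₊)
  let N : ℕ → ℕ := fun m => min ⌈pp m * Δ m⌉₊ (YY m / Δ m)
  have hΔ0 : ∀ m, 0 < Δ m := fun m => lt_of_lt_of_le one_pos (le_max_left _ _)
  have hΔY : ∀ m, Δ m ≤ YY m := fun m => max_le (by have := YY_two m; omega) (min_le_left _ _)
  have hN : ∀ m, N m * Δ m ≤ YY m := fun m =>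
    (Nat.mul_le_mul_right _ (min_le_right _ _)).trans (Nat.div_mul_le_self _ _)
  have hsc0 : ∀ m, 0 ≤ sc (YY m) := fun m => Real.sqrt_nonneg _
  have hΔs : ∀ᶠ m in atTop, (Δ m : ℝ) ≤ κ * sc (YY m) ∧ κ * sc (YY m) - 1 ≤ Δ m := by
    filter_upwards [YY_tendsto.eventually (sc_a hκ), YY_tendsto.eventually (sc_b hκ one_pos),
      YY_tendsto.eventually (eventually_ge_atTop 1)] with m h1 h2 h3
    have h4 : ⌊κ * sc (YY m)⌋₊ ≤ YY m := by
      have := Nat.floor_le_floor h1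
      rwa [Nat.floor_natCast] at this
    have h5 : 1 ≤ κ * sc (YY m) := by
      have := Real.rpow_nonneg (show (0:ℝ) ≤ YY m by positivity) (1/4:ℝ)
      linarith
    have e : Δ m = ⌊κ * sc (YY m)⌋₊ := by
      show max 1 (min (YY m) ⌊κ * sc (YY m)⌋₊) = _
      rw [min_eq_right h4, max_eq_right ((Nat.one_le_floor_iff _).2 h5)]
    rw [e]
    exact ⟨Nat.floor_le (by linarith), by linarith [Nat.lt_floor_add_one (κ * sc (YY m))]⟩
  have hpΔ : ∀ᶠ m in atTop, 1 ≤ pp m * Δ m := by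
    filter_upwards [hΔs, YY_tendsto.eventually (sc_c hκ (show (0:ℝ) < 4 by norm_num))] with m h1 h2
    have h3 : (m:ℝ) + 2 ≤ 2 * Real.log (YY m) := by
      have a := (YY_loglog m).1
      have b : Real.log (Real.log (YY m)) ≤ Real.log (YY m) :=
        Real.log_le_self (Real.log_natCast_nonneg _)
      have : (0:ℝ) ≤ m := Nat.cast_nonneg m
      linarith
    have h4 : ((m:ℝ) + 2) ^ 2 ≤ Δ m := by
      have : ((m:ℝ) + 2) ^ 2 ≤ (2 * Real.log (YY m)) ^ 2 := by gcongr
      linarith [h1.2]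
    calc (1:ℝ) = 1 / ((m:ℝ) + 2) ^ 2 * ((m:ℝ) + 2) ^ 2 := by field_simp
      _ ≤ pp m * Δ m := mul_le_mul (pp_ge m) h4 (by positivity) (pp_pos m).le
  have hpp : ∀ ε > 0, ∀ᶠ m in atTop, 2 * pp m * (Δ m : ℝ) ^ 2 ≤ ε * YY m := by
    intro ε hε
    have hlg : Tendsto (fun m : ℕ => Real.log ((m:ℝ) + 2)) atTop atTop :=
      Real.tendsto_log_atTop.comp (tendsto_atTop_add_const_right _ _ tendsto_natCast_atTop_atTop)
    filter_upwards [hΔs, hlg.eventually_ge_atTop (8 * κ ^ 2 / ε)] with m h1 h2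
    have hl := lg_pos m
    rw [div_le_iff₀ hε] at h2
    have hll := YY_loglog m
    have hm : (0:ℝ) ≤ m := Nat.cast_nonneg m
    have hs : (Δ m : ℝ) ^ 2 ≤ κ ^ 2 * (2 * YY m * (2 * ((m:ℝ) + 2))) := by
      calc (Δ m : ℝ) ^ 2 ≤ (κ * sc (YY m)) ^ 2 := by gcongr; exact h1.1
        _ = κ ^ 2 * (2 * YY m * Real.log (Real.log (YY m))) := by
          rw [mul_pow, sc, Real.sq_sqrt]
          have : 0 ≤ Real.log (Real.log (YY m)) := by linarith
          positivity
        _ ≤ _ := by gcongr; exact hll.2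
    calc 2 * pp m * (Δ m : ℝ) ^ 2 ≤ 2 * pp m * (κ ^ 2 * (2 * YY m * (2 * ((m:ℝ) + 2)))) := by
          have := (pp_pos m).le
          gcongr
      _ = (8 * κ ^ 2) / Real.log ((m:ℝ) + 2) * YY m := by
          unfold pp; field_simp; ring
      _ ≤ ε * YY m := by
          gcongr
          rw [div_le_iff₀ hl]; linarith
  have hNe : ∀ᶠ m in atTop, pp m * Δ m ≤ N m ∧ (N m : ℝ) ≤ 2 * (pp m * Δ m) := by
    filter_upwards [hpΔ, hpp 1 one_pos] with m h1 h2
    have hd : (0:ℝ) < Δ m := by exact_mod_cast hΔ0 m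
    have h3 : (⌈pp m * Δ m⌉₊ : ℝ) ≤ 2 * (pp m * Δ m) := by
      have := Nat.ceil_lt_add_one (show 0 ≤ pp m * Δ m by linarith)
      linarith
    have h4 : ⌈pp m * Δ m⌉₊ ≤ YY m / Δ m := by
      rw [Nat.le_div_iff_mul_le (hΔ0 m)]
      have : (⌈pp m * Δ m⌉₊ : ℝ) * Δ m ≤ YY m := by nlinarith
      exact_mod_cast this
    have e : N m = ⌈pp m * Δ m⌉₊ := min_eq_left h4
    rw [e]
    exact ⟨Nat.le_ceil _, h3⟩
  refine ⟨Δ, N, hΔ0, hΔY, hN, ?_, ?_, ?_, hΔs, ?_⟩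
  · rw [Metric.tendsto_nhds]
    intro ε hε
    filter_upwards [hΔs, YY_tendsto.eventually (sc_b hκ (half_pos hε))] with m h1 h2
    have hd : (0:ℝ) < Δ m := by exact_mod_cast hΔ0 m
    rw [Real.dist_0_eq_abs, abs_of_nonneg (by positivity), div_lt_iff₀ hd]
    have : ε / 2 * (κ * sc (YY m) - 1) ≤ ε / 2 * Δ m := by gcongr; exact h1.2
    have : 0 < ε * Δ m := by positivity
    linarith
  · refine Summable.of_norm_bounded_eventually_nat (pp_sq.mul_left 4) ?_
    filter_upwards [hNe] with m hm
    have hd : (0:ℝ) < Δ m := by exact_mod_cast hΔ0 m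
    rw [Real.norm_eq_abs, abs_of_nonneg (by positivity)]
    have : (N m : ℝ) / Δ m ≤ 2 * pp m := by rw [div_le_iff₀ hd]; linarith [hm.2]
    calc ((N m : ℝ) / Δ m) ^ 2 ≤ (2 * pp m) ^ 2 := by gcongr
      _ = _ := by ring
  · intro hs
    apply pp_not
    refine Summable.of_norm_bounded_eventually_nat hs ?_
    filter_upwards [hNe] with m hm
    have hd : (0:ℝ) < Δ m := by exact_mod_cast hΔ0 m
    rw [Real.norm_eq_abs, abs_of_nonneg (pp_pos m).le, le_div_iff₀ hd]
    exact hm.1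
  · intro ε hε
    filter_upwards [hNe, hpp ε hε] with m h1 h2
    push_cast
    have hd : (0:ℝ) < Δ m := by exact_mod_cast hΔ0 m
    nlinarith [h1.2]

end Part8

section Part9
open MeasureTheory Filter Finset Real ProbabilityTheory

/-- the exceptional set -/
def CC (f : ℝ → ℝ) (Y Δ N : ℕ → ℕ) (ω : ℕ → ℝ × ℝ) : Set ℕ :=
  {c | ∃ m j, j < N m * Δ m ∧ c = Y m + j ∧
    0 < f (((j % Δ m : ℕ) : ℝ) * (ω (Nat.pair m (j / Δ m))).1 + (ω (Nat.pair m (j / Δ m))).2)}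

/-- sums over a set -/
noncomputable def GG (C : Set ℕ) (g : ℕ → ℝ) (X : ℕ) : ℝ := ∑ c ∈ range X, C.indicator g c

section Comb
variable {f : ℝ → ℝ} {Y Δ N : ℕ → ℕ} {ω : ℕ → ℝ × ℝ}

theorem Y_mono (hY : ∀ m, 2 * Y m ≤ Y (m + 1)) : Monotone Y :=
  monotone_nat_of_le_succ fun m => by have := hY m; omega

theorem mem_CC (hY : ∀ m, 2 * Y m ≤ Y (m + 1)) (hN : ∀ m, N m * Δ m ≤ Y m) {m j : ℕ}
    (hj : Y m + j < Y (m + 1)) : Y m + j ∈ CC f Y Δ N ω ↔ j < N m * Δ m ∧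
      0 < f (((j % Δ m : ℕ) : ℝ) * (ω (Nat.pair m (j / Δ m))).1 + (ω (Nat.pair m (j / Δ m))).2) := by
  constructor
  · rintro ⟨m', j', h1, h2, h3⟩
    have hm : m = m' := by
      rcases lt_trichotomy m m' with h | h | h
      · have := Y_mono hY (show m + 1 ≤ m' from h)
        omega
      · exact h
      · have a := Y_mono hY (show m' + 1 ≤ m from h)
        have b := hY m'
        have c := hN m'
        omega
    subst hm
    have : j = j' := by omega
    subst this
    exact ⟨h1, h3⟩
  · rintro ⟨h1, h2⟩
    exact ⟨m, j, h1, rfl, h2⟩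

theorem ind_psi (hY : ∀ m, 2 * Y m ≤ Y (m + 1)) (hN : ∀ m, N m * Δ m ≤ Y m) {m j : ℕ} (y : ℝ)
    (hj : j < N m * Δ m) : (CC f Y Δ N ω).indicator (fun c => f (c * y)) (Y m + j) =
      psi f (((j % Δ m : ℕ) : ℝ) * (ω (Nat.pair m (j / Δ m))).1 + (ω (Nat.pair m (j / Δ m))).2) *
        f (((Y m:ℝ) + j) * y) := by
  have h1 := mem_CC (f := f) (ω := ω) hY hN (m := m) (j := j) (by have := hY m; have := hN m; omega)
  unfold psi
  split_ifs with h
  · rw [Set.indicator_of_mem (h1.2 ⟨hj, h⟩)]; push_cast; ring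
  · rw [Set.indicator_of_notMem fun hc => h (h1.1 hc).2]; ring

theorem GG_stage (hY : ∀ m, 2 * Y m ≤ Y (m + 1)) (hN : ∀ m, N m * Δ m ≤ Y m) (g : ℕ → ℝ) {m X : ℕ}
    (h1 : Y m ≤ X) (h2 : X ≤ Y (m + 1)) :
    GG (CC f Y Δ N ω) g X = GG (CC f Y Δ N ω) g (Y m) +
      ∑ j ∈ range (min (X - Y m) (N m * Δ m)), (CC f Y Δ N ω).indicator g (Y m + j) := by
  obtain ⟨t, rfl⟩ := Nat.exists_eq_add_of_le h1
  rw [GG, Finset.sum_range_add, GG, Nat.add_sub_cancel_left]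
  congr 1
  symm
  refine Finset.sum_subset (Finset.range_mono (min_le_left _ _)) fun j hj hj' => ?_
  rw [Finset.mem_range] at hj hj'
  apply Set.indicator_of_notMem
  rw [mem_CC hY hN (by omega)]
  rintro ⟨h, _⟩
  omega

theorem GG_St (hY : ∀ m, 2 * Y m ≤ Y (m + 1)) (hN : ∀ m, N m * Δ m ≤ Y m) (y : ℝ) {m X : ℕ}
    (h1 : Y m ≤ X) (h2 : X ≤ Y (m + 1)) :
    GG (CC f Y Δ N ω) (fun c => f (c * y)) X = GG (CC f Y Δ N ω) (fun c => f (c * y)) (Y m) +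
      St f y (Y m) (Δ m) (fun r => ω (Nat.pair m r)) (min (X - Y m) (N m * Δ m)) := by
  rw [GG_stage hY hN _ h1 h2]
  congr 1
  refine Finset.sum_congr rfl fun j hj => ?_
  rw [Finset.mem_range] at hj
  exact ind_psi hY hN y (by omega)

theorem ind_abs_le (C : Set ℕ) {g : ℕ → ℝ} {F : ℝ} (hg : ∀ c, |g c| ≤ F) (c : ℕ) :
    |C.indicator g c| ≤ F := by
  by_cases h : c ∈ C
  · rw [Set.indicator_of_mem h]; exact hg c
  · rw [Set.indicator_of_notMem h, abs_zero]; exact (abs_nonneg _).trans (hg 0)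

theorem sum_abs_le (C : Set ℕ) {g : ℕ → ℝ} {F : ℝ} (hg : ∀ c, |g c| ≤ F) (k t : ℕ) :
    |∑ j ∈ range t, C.indicator g (k + j)| ≤ F * t := by
  refine (Finset.abs_sum_le_sum_abs _ _).trans ((Finset.sum_le_sum fun j _ =>
    ind_abs_le C hg (k + j)).trans ?_)
  simp [mul_comm]

theorem GG_prev (hY : ∀ m, 2 * Y m ≤ Y (m + 1)) (hN : ∀ m, N m * Δ m ≤ Y m) {g : ℕ → ℝ}
    {F : ℝ} (hg : ∀ c, |g c| ≤ F) (m : ℕ) :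
    |GG (CC f Y Δ N ω) g (Y (m + 1))| ≤ F * (2 * Y m) := by
  have hF : 0 ≤ F := (abs_nonneg _).trans (hg 0)
  rw [GG_stage hY hN g (m := m) (by have := hY m; omega) le_rfl]
  refine (abs_add_le _ _).trans ?_
  have a : |GG (CC f Y Δ N ω) g (Y m)| ≤ F * Y m := by
    have := sum_abs_le (CC f Y Δ N ω) hg 0 (Y m)
    simpa [GG] using this
  have b := sum_abs_le (CC f Y Δ N ω) hg (Y m) (min (Y (m + 1) - Y m) (N m * Δ m))
  have c : ((min (Y (m + 1) - Y m) (N m * Δ m) : ℕ) : ℝ) ≤ Y m := by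
    exact_mod_cast (min_le_right _ _).trans (hN m)
  nlinarith

theorem GG_bound (hY : ∀ m, 2 * Y m ≤ Y (m + 1)) (hN : ∀ m, N m * Δ m ≤ Y m) {g : ℕ → ℝ}
    {F : ℝ} (hg : ∀ c, |g c| ≤ F) {m X : ℕ} (h1 : Y (m + 1) ≤ X) (h2 : X ≤ Y (m + 2)) :
    |GG (CC f Y Δ N ω) g X| ≤ F * (2 * Y m + (N (m + 1) * Δ (m + 1) : ℕ)) := by
  have hF : 0 ≤ F := (abs_nonneg _).trans (hg 0)
  rw [GG_stage hY hN g h1 h2]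
  refine (abs_add_le _ _).trans ?_
  have a := GG_prev (f := f) (ω := ω) hY hN hg m
  have b := sum_abs_le (CC f Y Δ N ω) hg (Y (m+1)) (min (X - Y (m + 1)) (N (m+1) * Δ (m+1)))
  have c : ((min (X - Y (m + 1)) (N (m+1) * Δ (m+1)) : ℕ) : ℝ) ≤ (N (m + 1) * Δ (m + 1) : ℕ) := by
    exact_mod_cast min_le_right _ _
  nlinarith
end Comb

/-- the kept integers -/
def AA (C : Set ℕ) : Set ℕ := {M | ¬ ∃ c ∈ C, M = 2 * c}

theorem odd_AA (C : Set ℕ) (k : ℕ) : 2 * k + 1 ∈ AA C := by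
  rintro ⟨c, _, h⟩; omega

theorem AA_inf (C : Set ℕ) : (AA C).Infinite :=
  Set.infinite_of_injective_forall_mem (f := fun k => 2 * k + 1) (fun a b h => by
    simp only at h; omega) (odd_AA C)

theorem GG_AA (C : Set ℕ) (g : ℕ → ℝ) (X : ℕ) :
    GG (AA C) g X = ∑ M ∈ range X, g M - GG C (fun c => g (2 * c)) ((X + 1) / 2) := by
  induction X with
  | zero => simp [GG]
  | succ X ih =>
    rcases Nat.even_or_odd' X with ⟨k, rfl | rfl⟩
    · have e1 : (2 * k + 1) / 2 = k := by omega
      have e2 : (2 * k + 1 + 1) / 2 = k + 1 := by omega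
      rw [e1] at ih
      rw [e2]
      unfold GG at ih ⊢
      rw [Finset.sum_range_succ, ih, Finset.sum_range_succ g, Finset.sum_range_succ _ k]
      by_cases hk : k ∈ C
      · have : 2 * k ∉ AA C := fun h => h ⟨k, hk, rfl⟩
        rw [Set.indicator_of_notMem this, Set.indicator_of_mem hk]; ring
      · have : 2 * k ∈ AA C := by
          rintro ⟨c, hc, h⟩
          have : k = c := by omega
          exact hk (this ▸ hc)
        rw [Set.indicator_of_mem this, Set.indicator_of_notMem hk]; ring
    · have e1 : (2 * k + 1 + 1) / 2 = k + 1 := by omega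
      have e2 : (2 * k + 1 + 1 + 1) / 2 = k + 1 := by omega
      rw [e1] at ih
      rw [e2]
      unfold GG at ih ⊢
      rw [Finset.sum_range_succ, ih, Finset.sum_range_succ g (2 * k + 1),
        Set.indicator_of_mem (odd_AA C k)]
      ring

section Nth
open Classical

/-- the sequence -/
noncomputable def nn (C : Set ℕ) (k : ℕ) : ℕ := Nat.nth (· ∈ AA C) k

theorem nn_mono (C : Set ℕ) : StrictMono (nn C) := Nat.nth_strictMono (AA_inf C)

theorem nn_zero {C : Set ℕ} (h0 : 0 ∉ C) : nn C 0 = 0 := by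
  apply Nat.nth_zero_of_zero
  rintro ⟨c, hc, h⟩
  have : c = 0 := by omega
  exact h0 (this ▸ hc)

theorem nn_gap (C : Set ℕ) (k : ℕ) : nn C (k + 1) ≤ nn C k + 2 := by
  have : ∃ M, nn C k < M ∧ M ≤ nn C k + 2 ∧ M ∈ AA C := by
    rcases Nat.even_or_odd' (nn C k) with ⟨a, h | h⟩
    · exact ⟨2 * a + 1, by omega, by omega, odd_AA C a⟩
    · exact ⟨2 * (a + 1) + 1, by omega, by omega, odd_AA C (a + 1)⟩
  obtain ⟨M, h1, h2, h3⟩ := this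
  have e : nn C (Nat.count (· ∈ AA C) M) = M := Nat.nth_count h3
  rw [← e] at h1
  have h4 := (nn_mono C).lt_iff_lt.1 h1
  have h5 := (nn_mono C).monotone (show k + 1 ≤ _ from h4)
  rw [e] at h5
  omega

theorem sum_nth (C : Set ℕ) (g : ℕ → ℝ) (X : ℕ) :
    GG (AA C) g X = ∑ k ∈ range (Nat.count (· ∈ AA C) X), g (nn C k) := by
  induction X with
  | zero => simp [GG]
  | succ X ih =>
    unfold GG at ih ⊢
    rw [Finset.sum_range_succ, ih, Nat.count_succ]
    by_cases h : X ∈ AA C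
    · rw [if_pos h, Finset.sum_range_succ, Set.indicator_of_mem h]
      congr 2
      exact (Nat.nth_count h).symm
    · rw [if_neg h, Set.indicator_of_notMem h, add_zero, add_zero]

theorem count_nn (C : Set ℕ) (K : ℕ) : Nat.count (· ∈ AA C) (nn C K + 1) = K + 1 :=
  Nat.count_nth_succ_of_infinite (p := (· ∈ AA C)) (AA_inf C) K

theorem sum_nn {C : Set ℕ} (h0 : 0 ∉ C) (g : ℕ → ℝ) (K : ℕ) :
    ∑ k ∈ Finset.Icc 1 K, g (nn C k) = ∑ M ∈ range (nn C K + 1), g M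
      - GG C (fun c => g (2 * c)) ((nn C K + 2) / 2) - g 0 := by
  have h1 := sum_nth C g (nn C K + 1)
  rw [count_nn, GG_AA] at h1
  have e : Finset.Icc 1 K = Finset.Ico (0 + 1) (K + 1) := by ext; simp [Nat.lt_succ_iff]
  have e2 : ∑ k ∈ range (K + 1), g (nn C k) = g 0 + ∑ k ∈ Finset.Icc 1 K, g (nn C k) := by
    rw [Finset.range_eq_Ico, Finset.sum_eq_sum_Ico_succ_bot (by omega), nn_zero h0, e]
  linarith

theorem card_nn (C : Set ℕ) (K : ℕ) :
    (K:ℝ) + 1 = (nn C K + 1 : ℕ) - GG C (fun _ => 1) ((nn C K + 2) / 2) := by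
  have h1 := sum_nth C (fun _ => 1) (nn C K + 1)
  rw [count_nn, GG_AA] at h1
  simp only [Finset.sum_const, Finset.card_range, nsmul_eq_mul, mul_one] at h1
  push_cast at h1 ⊢
  linarith

theorem odd_nn (C : Set ℕ) (W : ℕ) (hW : 0 < W) : ∃ K, nn C K = 2 * W - 1 := by
  refine ⟨Nat.count (· ∈ AA C) (2 * W - 1), Nat.nth_count ?_⟩
  have := odd_AA C (W - 1)
  rwa [show 2 * (W - 1) + 1 = 2 * W - 1 by omega] at this
end Nth

end Part9

section Part10
open MeasureTheory Filter Finset Real ProbabilityTheory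

/-- the normalisation -/
noncomputable def QQ (x : ℝ) : ℝ := Real.sqrt (x * Real.log (Real.log x))

theorem limsup_of {S : ℕ → ℝ} {L : ℝ}
    (hu : ∀ ε > 0, ∀ᶠ K : ℕ in atTop, |S K| ≤ (L + ε) * QQ K)
    (hl : ∀ ε > 0, ∃ᶠ K : ℕ in atTop, (L - ε) * QQ K ≤ |S K|) :
    atTop.limsup (fun K : ℕ => ((|S K| / QQ K : ℝ) : EReal)) = (L : EReal) := by
  have hQ : ∀ᶠ K : ℕ in atTop, 0 < QQ K := by
    filter_upwards [tendsto_natCast_atTop_atTop.eventually (loglog_atTop.eventually_gt_atTop 0),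
      eventually_gt_atTop 0] with K h1 h2
    have : (0:ℝ) < K := by exact_mod_cast h2
    exact Real.sqrt_pos.2 (by positivity)
  apply le_antisymm
  · rw [limsup_le_iff]
    intro z hz
    obtain ⟨r, h1, h2⟩ := EReal.lt_iff_exists_real_btwn.1 hz
    have h1 : L < r := by exact_mod_cast h1
    filter_upwards [hu (r - L) (by linarith), hQ] with K h3 h4
    refine lt_of_le_of_lt ?_ h2
    have : |S K| / QQ K ≤ r := by rw [div_le_iff₀ h4]; linarith
    exact_mod_cast this
  · rw [le_limsup_iff]
    intro z hz
    obtain ⟨r, h1, h2⟩ := EReal.lt_iff_exists_real_btwn.1 hz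
    have h2 : r < L := by exact_mod_cast h2
    refine ((hl (L - r) (by linarith)).and_eventually hQ).mono ?_
    rintro K ⟨h3, h4⟩
    refine lt_of_lt_of_le h1 ?_
    have : r ≤ |S K| / QQ K := by rw [le_div_iff₀ h4]; linarith
    exact_mod_cast this

theorem sc_le_QQ {x : ℝ} : sc x ≤ 2 * QQ x := by
  have : sc x = Real.sqrt 2 * QQ x := by
    rw [sc, QQ, mul_assoc, Real.sqrt_mul (by norm_num)]
  rw [this]
  have h2 : Real.sqrt 2 ≤ 2 := by
    rw [Real.sqrt_le_left (by norm_num)]; norm_num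
  exact mul_le_mul_of_nonneg_right h2 (Real.sqrt_nonneg _)

theorem quarter_QQ (A : ℝ) (hA : 0 ≤ A) {ε : ℝ} (hε : 0 < ε) :
    ∀ᶠ K : ℕ in atTop, A * (2 * (K:ℝ)) ^ (1/4:ℝ) ≤ ε * QQ K := by
  filter_upwards [tendsto_natCast_atTop_atTop.eventually
    (sc_b one_pos (show 0 < ε / (4 * (A + 1)) by positivity))] with K h
  have h1 : (2 * (K:ℝ)) ^ (1/4:ℝ) ≤ 2 * (K:ℝ) ^ (1/4:ℝ) := by
    rw [Real.mul_rpow (by norm_num) (by positivity)]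
    gcongr
    calc (2:ℝ) ^ (1/4:ℝ) ≤ 2 ^ (1:ℝ) := Real.rpow_le_rpow_of_exponent_le (by norm_num) (by norm_num)
      _ = 2 := by norm_num
  have h2 := sc_le_QQ (x := (K:ℝ))
  have h3 : (K:ℝ) ^ (1/4:ℝ) ≤ ε / (4 * (A + 1)) * (2 * QQ K) := by
    refine h.trans ?_
    gcongr
    linarith
  have hq : 0 ≤ QQ K := Real.sqrt_nonneg _
  calc A * (2 * (K:ℝ)) ^ (1/4:ℝ) ≤ (A + 1) * (2 * (ε / (4 * (A + 1)) * (2 * QQ K))) := by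
        refine mul_le_mul (by linarith) (h1.trans (by linarith)) (by positivity) (by linarith)
    _ = ε * QQ K := by field_simp; ring

theorem YY_sc (A : ℝ) {ε : ℝ} (hε : 0 < ε) :
    ∀ᶠ m in atTop, A * (YY m : ℝ) ≤ ε * sc (YY (m + 1)) := by
  have hY := YY_tendsto
  have hs : Tendsto (fun m => Real.sqrt (YY m)) atTop atTop := Real.tendsto_sqrt_atTop.comp hY
  filter_upwards [(tendsto_add_atTop_nat 1).eventually (hY.eventually sqrt_le_sc),
    hs.eventually_ge_atTop (A / ε)] with m h1 h2
  have e : Real.sqrt (YY (m + 1)) = YY m * Real.sqrt (YY m) := by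
    rw [YY_succ]; push_cast
    rw [show (YY m : ℝ) ^ 3 = YY m ^ 2 * YY m by ring, Real.sqrt_mul (by positivity),
      Real.sqrt_sq (by positivity)]
  rw [e] at h1
  rw [div_le_iff₀ hε] at h2
  calc A * (YY m : ℝ) ≤ Real.sqrt (YY m) * ε * YY m := by gcongr
    _ = ε * (YY m * Real.sqrt (YY m)) := by ring
    _ ≤ _ := by gcongr

theorem YY_step (m : ℕ) : 2 * YY m ≤ YY (m + 1) := by
  rw [YY_succ]
  have := YY_two m
  calc 2 * YY m ≤ YY m * YY m := Nat.mul_le_mul_right _ this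
    _ ≤ YY m ^ 3 := by nlinarith

section Fin
variable {f v : ℝ → ℝ} {V : ℝ} {Δ N : ℕ → ℕ} {ω : ℕ → ℝ × ℝ}

theorem zero_CC : 0 ∉ CC f YY Δ N ω := by
  rintro ⟨m, j, _, h, _⟩
  have := YY_two m
  omega

theorem GG_one_nonneg (C : Set ℕ) (X : ℕ) : 0 ≤ GG C (fun _ => 1) X :=
  Finset.sum_nonneg fun c _ => Set.indicator_nonneg (fun _ _ => zero_le_one) c

/-- size estimates -/
theorem size_est (hN : ∀ m, N m * Δ m ≤ YY m) {ε : ℝ} (hε1 : ε ≤ 1 / 4) {m K : ℕ}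
    (h3 : 2 * (YY m : ℝ) + (N (m + 1) * Δ (m + 1) : ℕ) + 2 ≤ ε * YY (m + 1))
    (hW1 : YY (m + 1) ≤ (nn (CC f YY Δ N ω) K + 2) / 2)
    (hW2 : (nn (CC f YY Δ N ω) K + 2) / 2 ≤ YY (m + 2)) :
    2 * (1 - ε) * YY (m + 1) ≤ K ∧ ((nn (CC f YY Δ N ω) K + 1 : ℕ) : ℝ) ≤ 2 * K ∧
    (YY (m + 1) : ℝ) ≤ K := by
  have hc := card_nn (CC f YY Δ N ω) K
  have hb := GG_bound (f := f) (ω := ω) YY_step hN (g := fun _ => 1) (F := 1) (by simp) hW1 hW2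
  have hb' := (abs_le.1 hb).2
  have hX : 2 * YY (m + 1) ≤ nn (CC f YY Δ N ω) K + 2 := by omega
  have hX' : 2 * (YY (m + 1) : ℝ) ≤ nn (CC f YY Δ N ω) K + 2 := by exact_mod_cast hX
  have hY2 : (2:ℝ) ≤ YY (m + 1) := by exact_mod_cast YY_two (m + 1)
  have hεY : ε * YY (m + 1) ≤ 1 / 4 * YY (m + 1) := by gcongr
  have hεY0 : 0 ≤ ε * YY (m + 1) := le_trans (by positivity) h3
  push_cast at hc h3 hb' hεY0 ⊢
  refine ⟨by nlinarith, by linarith, by linarith⟩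

/-- decomposition of the sum -/
theorem S_decomp (x : ℝ) (K : ℕ) :
    ∑ k ∈ Finset.Icc 1 K, f ((nn (CC f YY Δ N ω) k : ℝ) * x) =
      ∑ M ∈ range (nn (CC f YY Δ N ω) K + 1), f ((M:ℝ) * x)
      - GG (CC f YY Δ N ω) (fun c => f (c * (2 * x))) ((nn (CC f YY Δ N ω) K + 2) / 2) - f 0 := by
  have := sum_nn (zero_CC (f := f) (Δ := Δ) (N := N) (ω := ω)) (fun M => f ((M:ℝ) * x)) K
  rw [this]
  congr 2
  · congr 1
    funext c
    push_cast
    ring_nf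
  · simp

theorem E_bound (h : BVP f v V) (h0 : ∫ x in (0:ℝ)..1, f x = 0) {x C : ℝ} (hC : EqD x C) (X : ℕ) :
    |∑ M ∈ range X, f ((M:ℝ) * x)| ≤ C * V * (X:ℝ) ^ (1/4:ℝ) := by
  have := hC.2 f v V h 0 X
  simpa [h0] using this

theorem ev_stage (hT : ∀ ε > 0, ∀ᶠ m in atTop, ((N m * Δ m : ℕ):ℝ) ≤ ε * YY m) {ε : ℝ} (hε : 0 < ε) :
    ∀ᶠ m in atTop, 2 * (YY m : ℝ) + (N (m + 1) * Δ (m + 1) : ℕ) + 2 ≤ ε * YY (m + 1) := by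
  filter_upwards [(tendsto_add_atTop_nat 1).eventually (hT (ε / 2) (by positivity)),
    YY_sc 3 (half_pos hε), (tendsto_add_atTop_nat 1).eventually (YY_tendsto.eventually (sc_a one_pos))]
    with m h1 h2 h3
  have hY2 : (2:ℝ) ≤ YY m := by exact_mod_cast YY_two m
  have : ε / 2 * sc (YY (m + 1)) ≤ ε / 2 * YY (m + 1) := by gcongr; linarith
  linarith

theorem upper_case (h : BVP f v V) (h0 : ∫ x in (0:ℝ)..1, f x = 0) {H L : ℝ} (hH : 0 < H) (hL : 0 < L)
    (hN : ∀ m, N m * Δ m ≤ YY m)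
    (hΔs : ∀ᶠ m in atTop, (Δ m : ℝ) ≤ L / H * sc (YY m) ∧ L / H * sc (YY m) - 1 ≤ Δ m)
    (hT : ∀ ε > 0, ∀ᶠ m in atTop, ((N m * Δ m : ℕ):ℝ) ≤ ε * YY m)
    {x C : ℝ} (hC : EqD x C) (hc : ∀ δ > 0, Concl f H YY Δ N ω (2 * x) δ) :
    ∀ ε > 0, ∀ᶠ K : ℕ in atTop,
      |∑ k ∈ Finset.Icc 1 K, f ((nn (CC f YY Δ N ω) k : ℝ) * x)| ≤ (L + ε) * QQ K := by
  intro ε' hε'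
  set ε := min (1/4) (ε' / (L + 4)) with hε
  have e0 : 0 < ε := lt_min (by norm_num) (by positivity)
  have e1 : ε ≤ 1/4 := min_le_left _ _
  have e2 : (L + 4) * ε ≤ ε' := by
    have : ε ≤ ε' / (L + 4) := min_le_right _ _
    rw [le_div_iff₀ (by positivity)] at this; linarith
  have hF := h.bounded
  set F := |f 0| + V
  have hF0 : 0 ≤ F := (abs_nonneg _).trans (hF 0)
  have hCV : 0 ≤ C * V := mul_nonneg hC.1 h.V_nonneg
  have hκ : 0 < L / H := by positivity
  set δ := ε / (L / H) with hδ
  have hδ0 : 0 < δ := by positivity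
  have hδκ : δ * (L / H) = ε := by rw [hδ]; field_simp
  have s1 := tendsto_add_atTop_nat 1
  obtain ⟨m0, hm0⟩ := eventually_atTop.1 ((s1.eventually (hc δ hδ0).1).and ((s1.eventually hΔs).and
    ((ev_stage hT e0).and (YY_sc (3 * F) e0))))
  filter_upwards [quarter_QQ (C * V) hCV e0, eventually_ge_atTop (2 * YY (m0 + 1))] with K hK1 hK2
  have hnK : K ≤ nn (CC f YY Δ N ω) K := (nn_mono _).le_apply
  set W := (nn (CC f YY Δ N ω) K + 2) / 2 with hW
  have hWK : YY (m0 + 1) ≤ W := by omega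
  obtain ⟨m, hm, hW1, hW2⟩ : ∃ m ≥ m0, YY (m + 1) ≤ W ∧ W < YY (m + 2) := by
    have hex : ∃ m, W < YY (m + 2) := by
      refine ⟨W, ?_⟩
      have := YY_ge (W + 2)
      have : W + 2 + 2 < 2 ^ (W + 2 + 2) := Nat.lt_pow_self (by norm_num)
      omega
    classical
    refine ⟨Nat.find hex, ?_, ?_, Nat.find_spec hex⟩
    · by_contra hlt
      push Not at hlt
      have := Nat.find_spec hex
      have := Y_mono YY_step (show Nat.find hex + 2 ≤ m0 + 1 by omega)
      omega
    · rcases Nat.eq_zero_or_pos (Nat.find hex) with hz | hz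
      · rw [hz]
        exact (Y_mono YY_step (by omega)).trans hWK
      · have := Nat.find_min hex (m := Nat.find hex - 1) (by omega)
        push Not at this
        rwa [show Nat.find hex - 1 + 2 = Nat.find hex + 1 by omega] at this
  obtain ⟨a1, a2, a3, a4⟩ := hm0 m hm
  obtain ⟨z1, z2, z3⟩ := size_est hN e1 a3 hW1 hW2.le
  have hY2 : (2:ℝ) ≤ YY m := by exact_mod_cast YY_two m
  -- comparison of scales
  have hll : 0 ≤ Real.log (Real.log (YY (m + 1))) := by
    have := (YY_loglog (m + 1)).1
    have : (0:ℝ) ≤ ((m + 1 : ℕ):ℝ) := Nat.cast_nonneg _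
    linarith
  have hY1 : (2:ℝ) ≤ YY (m + 1) := by exact_mod_cast YY_two (m + 1)
  have hlm : Real.log (Real.log (YY (m + 1))) ≤ Real.log (Real.log K) := by
    apply Real.log_le_log (Real.log_pos (by linarith))
    exact Real.log_le_log (by linarith) z3
  have hsQ : sc (YY (m + 1)) ≤ (1 + ε) * QQ K := by
    have e : (1 + ε) * QQ K = Real.sqrt ((1 + ε) ^ 2 * (K * Real.log (Real.log K))) := by
      rw [Real.sqrt_mul (by positivity), Real.sqrt_sq (by linarith), QQ]
    rw [e, sc]
    apply Real.sqrt_le_sqrt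
    have p1 : (1:ℝ) ≤ (1 + ε) ^ 2 * (1 - ε) := by
      nlinarith [mul_nonneg e0.le (show (0:ℝ) ≤ 1 - ε - ε ^ 2 by nlinarith)]
    calc 2 * (YY (m + 1) : ℝ) * Real.log (Real.log (YY (m + 1)))
        ≤ ((1 + ε) ^ 2 * (1 - ε)) * (2 * (YY (m + 1) : ℝ) * Real.log (Real.log (YY (m + 1)))) :=
          le_mul_of_one_le_left (by positivity) p1
      _ = (1 + ε) ^ 2 * ((2 * (1 - ε) * YY (m + 1)) * Real.log (Real.log (YY (m + 1)))) := by ring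
      _ ≤ _ := by
        have : (0:ℝ) ≤ 2 * (1 - ε) * YY (m + 1) := by
          have : 0 ≤ 1 - ε := by linarith
          positivity
        gcongr
  rw [S_decomp]
  have hE := E_bound h h0 hC (nn (CC f YY Δ N ω) K + 1)
  have hE' : C * V * ((nn (CC f YY Δ N ω) K + 1 : ℕ):ℝ) ^ (1/4:ℝ) ≤ ε * QQ K :=
    (mul_le_mul_of_nonneg_left (rp_mono (by positivity) z2) hCV).trans hK1
  rw [← hW, GG_St YY_step hN _ hW1 hW2.le]
  have hp := GG_prev (f := f) (ω := ω) YY_step hN (g := fun c : ℕ => f (c * (2 * x)))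
    (fun c => hF _) m
  have hst := a1 (min (W - YY (m + 1)) (N (m + 1) * Δ (m + 1))) (min_le_right _ _)
  have hst2 : (H + δ) * Δ (m + 1) ≤ (L + ε) * sc (YY (m + 1)) := by
    calc (H + δ) * Δ (m + 1) ≤ (H + δ) * (L / H * sc (YY (m + 1))) := by gcongr; exact a2.1
      _ = (L + δ * (L / H)) * sc (YY (m + 1)) := by field_simp
      _ = _ := by rw [hδκ]
  have hs0 : 0 ≤ sc (YY (m + 1)) := Real.sqrt_nonneg _
  have hq0 : 0 ≤ QQ K := Real.sqrt_nonneg _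
  have hf0 := hF 0
  generalize GG (CC f YY Δ N ω) (fun c => f (c * (2 * x))) (YY (m + 1)) = G at *
  generalize St f (2 * x) (YY (m + 1)) (Δ (m + 1)) (fun r => ω (Nat.pair (m + 1) r))
    (min (W - YY (m + 1)) (N (m + 1) * Δ (m + 1))) = T at *
  generalize ∑ M ∈ range (nn (CC f YY Δ N ω) K + 1), f ((M:ℝ) * x) = E at *
  have hfin : |E - (G + T) - f 0| ≤ ε * QQ K + (L + 2 * ε) * sc (YY (m + 1)) := by
    have b1 : F ≤ F * YY m := le_mul_of_one_le_right hF0 (by linarith)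
    have b2 := (abs_sub (E - (G + T)) (f 0)).trans (add_le_add_left ((abs_sub E (G + T)).trans
      (add_le_add_right (abs_add_le G T) _)) _)
    linarith
  have : (L + 2 * ε) * sc (YY (m + 1)) ≤ (L + 2 * ε) * ((1 + ε) * QQ K) := by gcongr
  have p2 : ε + (L + 2 * ε) * (1 + ε) ≤ L + ε' := by nlinarith
  have p3 := mul_le_mul_of_nonneg_right p2 hq0
  linarith
end Fin

end Part10

section Part11
open MeasureTheory Filter Finset Real ProbabilityTheory

section Fin
variable {f v : ℝ → ℝ} {V : ℝ} {Δ N : ℕ → ℕ} {ω : ℕ → ℝ × ℝ}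

set_option maxHeartbeats 1600000 in
theorem lower_case (h : BVP f v V) (h0 : ∫ x in (0:ℝ)..1, f x = 0) {H L : ℝ} (hH : 0 < H) (hL : 0 < L)
    (hN : ∀ m, N m * Δ m ≤ YY m)
    (hΔs : ∀ᶠ m in atTop, (Δ m : ℝ) ≤ L / H * sc (YY m) ∧ L / H * sc (YY m) - 1 ≤ Δ m)
    (hT : ∀ ε > 0, ∀ᶠ m in atTop, ((N m * Δ m : ℕ):ℝ) ≤ ε * YY m)
    {x C : ℝ} (hC : EqD x C) (hc : ∀ δ > 0, Concl f H YY Δ N ω (2 * x) δ) :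
    ∀ ε > 0, ∃ᶠ K : ℕ in atTop,
      (L - ε) * QQ K ≤ |∑ k ∈ Finset.Icc 1 K, f ((nn (CC f YY Δ N ω) k : ℝ) * x)| := by
  intro ε' hε'
  set ε := min (1/4) (min (L / 2) (ε' / (L + 4))) with hε
  have e0 : 0 < ε := lt_min (by norm_num) (lt_min (by positivity) (by positivity))
  have e1 : ε ≤ 1/4 := min_le_left _ _
  have e3 : ε ≤ L / 2 := (min_le_right _ _).trans (min_le_left _ _)
  have e2 : (L + 4) * ε ≤ ε' := by
    have : ε ≤ ε' / (L + 4) := (min_le_right _ _).trans (min_le_right _ _)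
    rw [le_div_iff₀ (by positivity)] at this; linarith
  have hF := h.bounded
  set F := |f 0| + V
  have hF0 : 0 ≤ F := (abs_nonneg _).trans (hF 0)
  have hCV : 0 ≤ C * V := mul_nonneg hC.1 h.V_nonneg
  have hκ : 0 < L / H := by positivity
  set δ := ε / (L / H) with hδ
  have hδ0 : 0 < δ := by positivity
  have hδκ : δ * (L / H) = ε := by rw [hδ]; field_simp
  have s1 := tendsto_add_atTop_nat 1
  obtain ⟨m0, hm0⟩ := eventually_atTop.1 ((s1.eventually hΔs).and
    ((ev_stage hT e0).and ((YY_sc (H + 3 * F) e0).and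
      (s1.eventually ((loglog_atTop.comp YY_tendsto).eventually_ge_atTop (1 / ε))))))
  obtain ⟨k0, hk0⟩ := eventually_atTop.1 (quarter_QQ (C * V) hCV e0)
  rw [frequently_atTop]
  intro K0
  obtain ⟨M, hM, t, ht, hst⟩ := frequently_atTop.1 (hc δ hδ0).2 (max m0 (max k0 K0) + 1)
  obtain ⟨m, rfl⟩ : ∃ m, M = m + 1 := ⟨M - 1, by omega⟩
  have hm : m0 ≤ m := by omega
  obtain ⟨a2, a3, a4, a5⟩ := hm0 m hm
  have htY : t ≤ YY (m + 1) := ht.trans (hN _)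
  have hYs := YY_step (m + 1)
  have hY2 := YY_two m
  have hY2' := YY_two (m + 1)
  obtain ⟨K, hK⟩ := odd_nn (CC f YY Δ N ω) (YY (m + 1) + t) (by omega)
  have hW : (nn (CC f YY Δ N ω) K + 2) / 2 = YY (m + 1) + t := by omega
  obtain ⟨z1, z2, z3⟩ := size_est (f := f) (ω := ω) (K := K) hN e1 a3 (by omega)
    (by rw [hW]; rw [show m + 2 = m + 1 + 1 by rfl]; omega)
  have z3' : YY (m + 1) ≤ K := by exact_mod_cast z3
  have hYbig : m + 1 < YY (m + 1) := by
    have h1 := YY_ge (m + 1)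
    have h2 : m + 1 + 2 < 2 ^ (m + 1 + 2) := Nat.lt_pow_self (by norm_num)
    omega
  refine ⟨K, by omega, ?_⟩
  have hK1 := hk0 K (by omega)
  have hY2 : (2:ℝ) ≤ YY m := by exact_mod_cast YY_two m
  have hY1 : (2:ℝ) ≤ YY (m + 1) := by exact_mod_cast YY_two (m + 1)
  have hY4 : (4:ℝ) ≤ YY (m + 1) := by
    have := YY_step m
    have : 2 * (YY m : ℝ) ≤ YY (m + 1) := by exact_mod_cast this
    linarith
  have hKu : (K:ℝ) ≤ 2 * (1 + ε) * YY (m + 1) := by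
    have c1 := card_nn (CC f YY Δ N ω) K
    have c2 := GG_one_nonneg (CC f YY Δ N ω) ((nn (CC f YY Δ N ω) K + 2) / 2)
    have c3 : (nn (CC f YY Δ N ω) K : ℝ) ≤ 2 * (YY (m + 1) + t) := by
      have : nn (CC f YY Δ N ω) K ≤ 2 * (YY (m + 1) + t) := by omega
      exact_mod_cast this
    have c4 : (t:ℝ) ≤ (N (m + 1) * Δ (m + 1) : ℕ) := by exact_mod_cast ht
    push_cast at c1 c4 a3
    nlinarith
  have hll : 0 ≤ Real.log (Real.log (YY (m + 1))) := le_trans (by positivity) a5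
  have hlm : Real.log (Real.log (YY (m + 1))) ≤ Real.log (Real.log K) := by
    apply Real.log_le_log (Real.log_pos (by linarith))
    exact Real.log_le_log (by linarith) z3
  have hlu : Real.log (Real.log K) ≤ (1 + ε) * Real.log (Real.log (YY (m + 1))) := by
    have d1 : Real.log K ≤ 2 * Real.log (YY (m + 1)) := by
      have : Real.log ((YY (m + 1) : ℝ) ^ 2) = 2 * Real.log (YY (m + 1)) := by
        rw [Real.log_pow]; norm_num
      rw [← this]
      apply Real.log_le_log (by linarith)
      nlinarith
    have d2 : 0 < Real.log (YY (m + 1)) := Real.log_pos (by linarith)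
    have d3 : Real.log (Real.log K) ≤ Real.log (2 * Real.log (YY (m + 1))) :=
      Real.log_le_log (Real.log_pos (by linarith)) d1
    rw [Real.log_mul (by norm_num) d2.ne'] at d3
    have d4 : Real.log 2 ≤ 1 := by linarith [Real.log_two_lt_d9]
    have d5 : 1 ≤ ε * Real.log (Real.log (YY (m + 1))) := by
      have : 1 / ε ≤ Real.log (Real.log (YY (m + 1))) := a5
      rw [div_le_iff₀ e0] at this; linarith
    linarith
  have hs0 : 0 ≤ sc (YY (m + 1)) := Real.sqrt_nonneg _
  have hq0 : 0 ≤ QQ K := Real.sqrt_nonneg _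
  have hsQ : QQ K ≤ (1 + ε) * sc (YY (m + 1)) := by
    have e : (1 + ε) * sc (YY (m + 1)) =
        Real.sqrt ((1 + ε) ^ 2 * (2 * YY (m + 1) * Real.log (Real.log (YY (m + 1))))) := by
      rw [Real.sqrt_mul (by positivity), Real.sqrt_sq (by linarith), sc]
    rw [e, QQ]
    apply Real.sqrt_le_sqrt
    calc (K:ℝ) * Real.log (Real.log K)
        ≤ (2 * (1 + ε) * YY (m + 1)) * ((1 + ε) * Real.log (Real.log (YY (m + 1)))) :=
          mul_le_mul hKu hlu (hll.trans hlm) (by positivity)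
      _ = _ := by ring
  have hsQ' : (1 - ε) * QQ K ≤ sc (YY (m + 1)) := by
    have := mul_le_mul_of_nonneg_left hsQ (show 0 ≤ 1 - ε by linarith)
    have h2 := mul_nonneg (mul_nonneg e0.le e0.le) hs0
    linarith
  rw [S_decomp]
  have hE := E_bound h h0 hC (nn (CC f YY Δ N ω) K + 1)
  have hE' : C * V * ((nn (CC f YY Δ N ω) K + 1 : ℕ):ℝ) ^ (1/4:ℝ) ≤ ε * QQ K :=
    (mul_le_mul_of_nonneg_left (rp_mono (by positivity) z2) hCV).trans hK1
  rw [hW, GG_St (m := m + 1) YY_step hN _ (by omega) (by omega), Nat.add_sub_cancel_left, min_eq_left ht]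
  have hp := GG_prev (f := f) (ω := ω) YY_step hN (g := fun c : ℕ => f (c * (2 * x)))
    (fun c => hF _) m
  have hst2 : (L - ε) * sc (YY (m + 1)) - H ≤ (H - δ) * Δ (m + 1) := by
    have g1 : δ * Δ (m + 1) ≤ ε * sc (YY (m + 1)) := by
      calc δ * Δ (m + 1) ≤ δ * (L / H * sc (YY (m + 1))) := by gcongr; exact a2.1
        _ = _ := by rw [← mul_assoc, hδκ]
    have g2 : L * sc (YY (m + 1)) - H ≤ H * Δ (m + 1) := by
      calc L * sc (YY (m + 1)) - H = H * (L / H * sc (YY (m + 1)) - 1) := by field_simp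
        _ ≤ _ := by gcongr; exact a2.2
    linarith
  have hf0 := hF 0
  generalize GG (CC f YY Δ N ω) (fun c => f (c * (2 * x))) (YY (m + 1)) = G at *
  generalize St f (2 * x) (YY (m + 1)) (Δ (m + 1)) (fun r => ω (Nat.pair (m + 1) r)) t = T at *
  generalize ∑ M ∈ range (nn (CC f YY Δ N ω) K + 1), f ((M:ℝ) * x) = E at *
  have hfin : (L - 2 * ε) * sc (YY (m + 1)) - ε * QQ K ≤ |E - (G + T) - f 0| := by
    have b1 : F ≤ F * YY m := le_mul_of_one_le_right hF0 (by linarith)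
    have b0 : H ≤ H * YY m := le_mul_of_one_le_right hH.le (by linarith)
    have b2 := neg_abs_le (E - (G + T) - f 0)
    have b3 := le_abs_self E
    have b4 := neg_abs_le G
    have b5 := neg_abs_le (f 0)
    linarith
  have : (L - 2 * ε) * ((1 - ε) * QQ K) ≤ (L - 2 * ε) * sc (YY (m + 1)) :=
    mul_le_mul_of_nonneg_left hsQ' (by linarith)
  have p2 : L - ε' ≤ (L - 2 * ε) * (1 - ε) - ε := by nlinarith
  have p3 := mul_le_mul_of_nonneg_right p2 hq0
  linarith
end Fin

theorem zero_case {f v : ℝ → ℝ} {V : ℝ} (h : BVP f v V) (h0 : ∫ x in (0:ℝ)..1, f x = 0) {x C : ℝ}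
    (hC : EqD x C) : ∀ ε > 0, ∀ᶠ K : ℕ in atTop,
      |∑ k ∈ Finset.Icc 1 K, f ((k : ℝ) * x)| ≤ (0 + ε) * QQ K := by
  intro ε hε
  have hCV : 0 ≤ C * V := mul_nonneg hC.1 h.V_nonneg
  filter_upwards [quarter_QQ (C * V + |f 0|) (by positivity) hε, eventually_ge_atTop 1] with K hK h1
  have h1' : (1:ℝ) ≤ K := by exact_mod_cast h1
  have e : ∑ k ∈ Finset.Icc 1 K, f ((k : ℝ) * x) = ∑ M ∈ range (K + 1), f ((M:ℝ) * x) - f 0 := by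
    rw [Finset.sum_range_succ', Finset.range_eq_Ico, Finset.sum_Ico_add' (fun M : ℕ => f ((M:ℝ) * x))]
    simp
    rfl
  rw [e, zero_add]
  have hE := E_bound h h0 hC (K + 1)
  have r1 : ((K + 1 : ℕ):ℝ) ^ (1/4:ℝ) ≤ (2 * (K:ℝ)) ^ (1/4:ℝ) :=
    rp_mono (by positivity) (by push_cast; linarith)
  have r2 : (1:ℝ) ≤ (2 * (K:ℝ)) ^ (1/4:ℝ) := Real.one_le_rpow (by linarith) (by norm_num)
  have r3 := mul_le_mul_of_nonneg_left r1 hCV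
  have r4 := mul_le_mul_of_nonneg_left r2 (abs_nonneg (f 0))
  have r5 := abs_sub (∑ M ∈ range (K + 1), f ((M:ℝ) * x)) (f 0)
  linarith


theorem H_pos {f v : ℝ → ℝ} {V : ℝ} (h : BVP f v V) (h0 : ∫ x in (0:ℝ)..1, f x = 0)
    (hf : L2norm f ≠ 0) : 0 < ∫ x in (0:ℝ)..1, max (f x) 0 := by
  have hnn : 0 ≤ ∫ x in (0:ℝ)..1, max (f x) 0 :=
    intervalIntegral.integral_nonneg (by norm_num) fun _ _ => le_max_right _ _
  refine lt_of_le_of_ne hnn fun hz => hf ?_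
  have hn := int_neg_part h h0
  rw [← hz] at hn
  have hmeas : ∀ g : ℝ → ℝ, Measurable g → (∀ x, |g x| ≤ |f 0| + V) →
      IntegrableOn g (Set.Ioc 0 1) := by
    intro g hg hb
    exact Measure.integrableOn_of_bounded (M := |f 0| + V) (by simp) hg.aestronglyMeasurable
      (Eventually.of_forall hb)
  have i1 := hmeas (fun x => max (f x) 0) (h.meas.max measurable_const) fun x => by
    have := h.bounded x
    rw [abs_of_nonneg (le_max_right _ _)]
    exact max_le ((le_abs_self _).trans this) ((abs_nonneg _).trans this)
  have i2 := hmeas (fun x => max (-f x) 0) (h.meas.neg.max measurable_const) fun x => by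
    have := h.bounded x
    rw [abs_of_nonneg (le_max_right _ _)]
    exact max_le ((neg_le_abs _).trans this) ((abs_nonneg _).trans this)
  rw [intervalIntegral.integral_of_le (by norm_num)] at hz hn
  have j1 := (integral_eq_zero_iff_of_nonneg (fun x => le_max_right _ _) i1).1 hz.symm
  have j2 := (integral_eq_zero_iff_of_nonneg (fun x => le_max_right _ _) i2).1 hn
  rw [L2norm, intervalIntegral.integral_of_le (by norm_num), integral_eq_zero_of_ae, Real.sqrt_zero]
  filter_upwards [j1, j2] with x k1 k2
  simp only [Pi.zero_apply, max_eq_right_iff] at k1 k2 ⊢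
  rw [le_antisymm k1 (by linarith)]
  norm_num

theorem ae_two {p : ℝ → Prop} (hp : ∀ᵐ y : ℝ, p y) : ∀ᵐ x : ℝ, p (2 * x) := by
  have hq : Measure.QuasiMeasurePreserving (fun x : ℝ => 2 * x) volume volume := by
    refine ⟨measurable_const_mul 2, ?_⟩
    rw [Real.map_volume_mul_left (by norm_num)]
    exact Measure.smul_absolutelyContinuous
  exact hq.ae hp

end Part11

theorem lil_bounded_gaps_single_function
    (Λ : ℝ) (hΛ : 0 ≤ Λ) (f : ℝ → ℝ)
    (hper : ∀ x : ℝ, f (x + 1) = f x)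
    (hint : (∫ x in (0:ℝ)..1, f x) = 0)
    (hbv : BoundedVariationOn f (Set.Icc 0 1)) :
    ∃ n : ℕ → ℕ,
      (∀ k, 1 ≤ k → 0 < n k) ∧
      (∀ k, 1 ≤ k → n k < n (k + 1)) ∧
      (∀ k, 1 ≤ k → n (k + 1) - n k = 1 ∨ n (k + 1) - n k = 2) ∧
      (∀ᵐ x ∂(volume : Measure ℝ),
        Filter.atTop.limsup (fun N : ℕ =>
            ((|∑ k ∈ Finset.Icc 1 N, f ((n k : ℝ) * x)| /
              Real.sqrt (N * Real.log (Real.log N)) : ℝ) : EReal))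
          = ((Λ * L2norm f : ℝ) : EReal)) := by
  obtain ⟨v, V, h⟩ := exists_BVP f hper hbv
  have hL0 : 0 ≤ Λ * L2norm f := mul_nonneg hΛ (Real.sqrt_nonneg _)
  rcases hL0.eq_or_lt with hz | hL
  · refine ⟨id, fun k hk => hk, fun k _ => Nat.lt_succ_self k, fun k _ => Or.inl (by simp), ?_⟩
    filter_upwards [ae_eqD] with x hx
    obtain ⟨C, hC⟩ := hx
    rw [← hz]
    refine limsup_of (S := fun K => ∑ k ∈ Finset.Icc 1 K, f (((id k : ℕ) : ℝ) * x))
      (zero_case h hint hC) fun ε hε => ?_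
    refine Eventually.frequently (Eventually.of_forall fun K => ?_)
    have : 0 ≤ QQ K := Real.sqrt_nonneg _
    refine le_trans ?_ (abs_nonneg _)
    nlinarith
  · have hne : L2norm f ≠ 0 := fun hz => by simp [hz] at hL
    have hH := H_pos h hint hne
    obtain ⟨Δ, N, q1, q2, q3, q4, q5, q6, q7, q8⟩ := exists_params (div_pos hL hH)
    obtain ⟨ω, hω⟩ := stage_all h hint rfl hH YY Δ N q1 q2 q3 q4 q5 q6
    have hz := nn_zero (zero_CC (f := f) (Δ := Δ) (N := N) (ω := ω))
    refine ⟨nn (CC f YY Δ N ω), fun k hk => ?_, fun k _ => nn_mono _ (Nat.lt_succ_self k),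
      fun k _ => ?_, ?_⟩
    · have := nn_mono (CC f YY Δ N ω) (show 0 < k by omega)
      omega
    · have h1 := nn_gap (CC f YY Δ N ω) k
      have h2 := nn_mono (CC f YY Δ N ω) (Nat.lt_succ_self k)
      simp only [Nat.succ_eq_add_one] at h2
      omega
    · filter_upwards [ae_eqD, ae_two hω] with x hx hc
      obtain ⟨C, hC⟩ := hx
      exact limsup_of (S := fun K => ∑ k ∈ Finset.Icc 1 K, f ((nn (CC f YY Δ N ω) k : ℝ) * x))
        (upper_case h hint hH hL q3 q7 q8 hC hc) (lower_case h hint hH hL q3 q7 q8 hC hc)
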